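/- arXiv:math/9401218 — 5 statements merged into one kernel-verified Lean document; each statement's English description precedes it below -/
import Mathlib

section
/- For every natural number n ≥ 1 and every injective function F from ℕ^n (the set of functions from {0,…,n−1} to ℕ) to the unit interval [0,1], there exists a full subset T ⊆ ℕ^n such that the image F''T is a discrete subset of [0,1]. -/
/-- A set `X` of functions from `{0,…,n-1}` to `ℕ` is *full* if it is nonempty and
for every `x ∈ X` and every `i < n` there is an infinite set `A ⊆ ℕ` such that for
every `m ∈ A` there is `y ∈ X` with `y ↾ i = x ↾ i` and `y i = m`. -/
def IsFullSubset (n : ℕ) (X : Set (Fin n → ℕ)) : Prop :=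
  X.Nonempty ∧ ∀ x ∈ X, ∀ i : Fin n, ∃ A : Set ℕ, A.Infinite ∧
    ∀ m ∈ A, ∃ y ∈ X, (∀ j : Fin n, (j : ℕ) < (i : ℕ) → y j = x j) ∧ y i = m

/-- A subset `D` of `[0,1]` is discrete if every `d ∈ D` has an open neighbourhood
`U` (open in `[0,1]`) with `U ∩ D = {d}`. -/
def IsDiscreteSubset (D : Set unitInterval) : Prop :=
  ∀ d ∈ D, ∃ U : Set unitInterval, IsOpen U ∧ U ∩ D = {d}

open Filter Topology

/-- Any function into a compact space defined on the sequences of length `n` extends to all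
finite sequences in such a way that the value at each shorter sequence is the limit, along a fixed
nonprincipal ultrafilter, of the values at its one-term extensions. -/
theorem exists_extension_tendsto_hyperfilter {X : Type*} [TopologicalSpace X] [CompactSpace X]
    (n : ℕ) (f : List ℕ → X) :
    ∃ G : List ℕ → X, (∀ s, s.length = n → G s = f s) ∧
      ∀ s, s.length < n → Tendsto (fun m => G (s ++ [m])) (hyperfilter ℕ) (𝓝 (G s)) := by
  let H : ℕ → List ℕ → X := fun k => Nat.rec f
    (fun _ h s => @Ultrafilter.lim _ _ ((hyperfilter ℕ).map fun m => h (s ++ [m]))) k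
  refine ⟨fun s => H (n - s.length) s, fun s hs => by simp [hs, H], fun s hs => ?_⟩
  obtain ⟨k, hk⟩ : ∃ k, n - s.length = k + 1 := ⟨n - s.length - 1, by omega⟩
  have hk' : ∀ m : ℕ, n - (s ++ [m]).length = k := fun m => by simp; omega
  simp only [hk, hk']
  exact Ultrafilter.le_nhds_lim ((hyperfilter ℕ).map fun m => H k (s ++ [m]))

/-- A finite approximation to a tree of sequences of length at most `n`, together with a closed
set guarding the values of `G` at the sequences of length `n` chosen so far. -/
structure GuardedTree {X : Type*} [TopologicalSpace X] (n : ℕ) (G : List ℕ → X) where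
  nodes : Finset (List ℕ)
  guard : Set X
  isClosed_guard : IsClosed guard
  nil_mem : [] ∈ nodes
  parent_mem : ∀ s m, s ++ [m] ∈ nodes → s ∈ nodes
  notMem_guard : ∀ s ∈ nodes, s.length < n → G s ∉ guard
  guard_mem_nhds : ∀ s ∈ nodes, s.length = n → guard ∈ 𝓝 (G s)

namespace GuardedTree

variable {X : Type*} [TopologicalSpace X] {n : ℕ} {G : List ℕ → X}

instance : Preorder (GuardedTree n G) where
  le p q := p.nodes ⊆ q.nodes ∧ p.guard ⊆ q.guard ∧
    ∀ s ∈ q.nodes, s.length = n → G s ∈ p.guard → s ∈ p.nodes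
  le_refl p := ⟨subset_rfl, subset_rfl, fun _ hs _ _ => hs⟩
  le_trans p q r hpq hqr := ⟨hpq.1.trans hqr.1, hpq.2.1.trans hqr.2.1, fun s hs hn hg =>
    hpq.2.2 s (hqr.2.2 s hs hn (hpq.2.1 hg)) hn hg⟩

/-- The tree consisting of the root only. -/
def root (hn : 1 ≤ n) : GuardedTree n G where
  nodes := {[]}
  guard := ∅
  isClosed_guard := isClosed_empty
  nil_mem := by simp
  parent_mem := by simp
  notMem_guard := by simp
  guard_mem_nhds := by
    intro s hs hl
    rw [Finset.mem_singleton] at hs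
    subst hs
    simp at hl
    omega

theorem exists_le_append_mem [T3Space X] (hinj : Set.InjOn G {s | s.length = n})
    (hlim : ∀ s, s.length < n → Tendsto (fun m => G (s ++ [m])) (hyperfilter ℕ) (𝓝 (G s)))
    (p : GuardedTree n G) {s : List ℕ} (hs : s ∈ p.nodes) (hsn : s.length < n) (k : ℕ) :
    ∃ q, p ≤ q ∧ ∃ m, k ≤ m ∧ s ++ [m] ∈ q.nodes := by
  classical
  have hguard : ∀ᶠ m in (hyperfilter ℕ : Filter ℕ), G (s ++ [m]) ∉ p.guard :=
    (hlim s hsn).eventually (p.isClosed_guard.isOpen_compl.mem_nhds (p.notMem_guard s hs hsn))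
  have hlarge : ∀ᶠ m in (hyperfilter ℕ : Filter ℕ), k ≤ m :=
    hyperfilter_le_cofinite (Nat.cofinite_eq_atTop ▸ eventually_ge_atTop k)
  have hne : ∀ᶠ m in (hyperfilter ℕ : Filter ℕ), ∀ t ∈ p.nodes,
      s.length + 1 = n → G (s ++ [m]) ≠ G t := by
    rw [eventually_all_finset]
    refine fun t _ => hyperfilter_le_cofinite ?_
    rw [mem_cofinite]
    refine Set.Subsingleton.finite fun a ha b hb => ?_
    simp only [Set.mem_compl_iff, Set.mem_ofPred_eq, Classical.not_imp, not_not] at ha hb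
    have := hinj (by simpa using ha.1) (by simpa using ha.1) (ha.2.trans hb.2.symm)
    simpa using this
  obtain ⟨m, hm, hkm, hmt⟩ := (hguard.and (hlarge.and hne)).exists
  obtain ⟨K, hKc, hKmem, hKt, hKm⟩ : ∃ K : Set X, IsClosed K ∧
      (s.length + 1 = n → K ∈ 𝓝 (G (s ++ [m]))) ∧
      (∀ t ∈ p.nodes, t.length < n → G t ∉ K) ∧ (s.length + 1 < n → G (s ++ [m]) ∉ K) := by
    by_cases hn : s.length + 1 = n
    · have hfin : (G '' p.nodes)ᶜ ∈ 𝓝 (G (s ++ [m])) := by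
        refine (p.nodes.finite_toSet.image G).isClosed.isOpen_compl.mem_nhds ?_
        rintro ⟨t, ht, h⟩
        exact hmt t ht hn h.symm
      obtain ⟨K, hK, hKc, hKs⟩ := exists_mem_nhds_isClosed_subset hfin
      exact ⟨K, hKc, fun _ => hK, fun t ht _ h => hKs h ⟨t, ht, rfl⟩, fun h => by omega⟩
    · exact ⟨∅, isClosed_empty, fun h => absurd h hn, by simp, by simp⟩
  refine ⟨⟨insert (s ++ [m]) p.nodes, p.guard ∪ K, p.isClosed_guard.union hKc,
    Finset.mem_insert_of_mem p.nil_mem, ?_, ?_, ?_⟩, ⟨Finset.subset_insert _ _,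
    Set.subset_union_left, ?_⟩, m, hkm, Finset.mem_insert_self _ _⟩
  · intro t a ht
    rcases Finset.mem_insert.1 ht with h | h
    · rw [(List.append_inj' h rfl).1]
      exact Finset.mem_insert_of_mem hs
    · exact Finset.mem_insert_of_mem (p.parent_mem t a h)
  · intro t ht htn
    rcases Finset.mem_insert.1 ht with rfl | h
    · exact fun h => h.elim hm (hKm (by simpa using htn))
    · exact fun h' => h'.elim (p.notMem_guard t h htn) (hKt t h htn)
  · intro t ht htn
    rcases Finset.mem_insert.1 ht with rfl | h
    · exact mem_of_superset (hKmem (by simpa using htn)) Set.subset_union_right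
    · exact mem_of_superset (p.guard_mem_nhds t h htn) Set.subset_union_left
  · intro t ht _ htg
    rcases Finset.mem_insert.1 ht with rfl | h
    · exact absurd htg hm
    · exact h

end GuardedTree

/-- If `G` is injective on the sequences of length `n` and continuous at shorter sequences along a
nonprincipal ultrafilter, then some infinitely branching tree of height `n` has leaves on which
the values of `G` are isolated from each other. -/
theorem exists_tree_isolated_leaves {X : Type*} [TopologicalSpace X] [T3Space X] {n : ℕ}
    (hn : 1 ≤ n) {G : List ℕ → X} (hinj : Set.InjOn G {s | s.length = n})
    (hlim : ∀ s, s.length < n → Tendsto (fun m => G (s ++ [m])) (hyperfilter ℕ) (𝓝 (G s))) :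
    ∃ A : Set (List ℕ), [] ∈ A ∧ (∀ s m, s ++ [m] ∈ A → s ∈ A) ∧
      (∀ s ∈ A, s.length < n → ∀ k, ∃ m, k ≤ m ∧ s ++ [m] ∈ A) ∧
      ∀ s ∈ A, s.length = n → ∃ U, IsOpen U ∧ G s ∈ U ∧
        ∀ t ∈ A, t.length = n → G t ∈ U → t = s := by
  let D : {s : List ℕ // s.length < n} × ℕ → Order.Cofinal (GuardedTree n G) := fun i =>
    { carrier := {p | (∃ m, i.2 ≤ m ∧ i.1.1 ++ [m] ∈ p.nodes) ∨ ∀ q, p ≤ q → i.1.1 ∉ q.nodes}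
      isCofinal := fun p => by
        by_cases h : ∃ q, p ≤ q ∧ i.1.1 ∈ q.nodes
        · obtain ⟨q, hpq, hq⟩ := h
          obtain ⟨r, hqr, hr⟩ := q.exists_le_append_mem hinj hlim hq i.1.2 i.2
          exact ⟨r, Or.inl hr, hpq.trans hqr⟩
        · push Not at h
          exact ⟨p, Or.inr h, le_rfl⟩ }
  let I := Order.idealOfCofinals (GuardedTree.root (G := G) hn) D
  refine ⟨{s | ∃ p ∈ I, s ∈ p.nodes},
    ⟨_, Order.mem_idealOfCofinals _ _, GuardedTree.nil_mem _⟩, ?_, ?_, ?_⟩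
  · rintro s m ⟨p, hp, hs⟩
    exact ⟨p, hp, p.parent_mem s m hs⟩
  · rintro s ⟨p, hp, hs⟩ hsn k
    obtain ⟨q, hqD, hq⟩ := Order.cofinal_meets_idealOfCofinals
      (GuardedTree.root (G := G) hn) D (⟨s, hsn⟩, k)
    rcases hqD with ⟨m, hkm, hm⟩ | h
    · exact ⟨m, hkm, q, hq, hm⟩
    · obtain ⟨r, -, hpr, hqr⟩ := I.directed p hp q hq
      exact absurd (hpr.1 hs) (h r hqr)
  · rintro s ⟨p, hp, hs⟩ hsn
    refine ⟨interior p.guard ∩ (G '' {t | t ∈ p.nodes ∧ t.length = n ∧ t ≠ s})ᶜ,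
      isOpen_interior.inter (Set.Finite.isClosed ?_).isOpen_compl,
      ⟨mem_interior_iff_mem_nhds.2 (p.guard_mem_nhds s hs hsn), ?_⟩, ?_⟩
    · exact (p.nodes.finite_toSet.subset fun t ht => ht.1).image G
    · rintro ⟨t, ⟨-, htn, hts⟩, h⟩
      exact hts (hinj htn hsn h)
    · rintro t ⟨q, hq, ht⟩ htn ⟨htg, hti⟩
      obtain ⟨r, -, hpr, hqr⟩ := I.directed p hp q hq
      have htp := hpr.2.2 t (hqr.1 ht) htn (interior_subset htg)
      by_contra hts
      exact hti ⟨t, ⟨htp, htn, hts⟩, rfl⟩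

theorem full_subset_with_discrete_image (n : ℕ) (hn : 1 ≤ n)
    (F : (Fin n → ℕ) → unitInterval) (hF : Function.Injective F) :
    ∃ T : Set (Fin n → ℕ), IsFullSubset n T ∧ IsDiscreteSubset (F '' T) := by
  obtain ⟨G, hGF, hlim⟩ := exists_extension_tendsto_hyperfilter n
    fun s => F fun i : Fin n => s.getD i 0
  have hGofFn : ∀ x : Fin n → ℕ, G (List.ofFn x) = F x := fun x => by
    rw [hGF _ List.length_ofFn]
    simp
  have hofFn : ∀ s : List ℕ, s.length = n → ∃ x : Fin n → ℕ, List.ofFn x = s := by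
    rintro s rfl
    exact ⟨s.get, List.ofFn_get s⟩
  have hinj : Set.InjOn G {s | s.length = n} := by
    intro s hs t ht h
    obtain ⟨x, rfl⟩ := hofFn s hs
    obtain ⟨y, rfl⟩ := hofFn t ht
    rw [hGofFn, hGofFn] at h
    rw [hF h]
  obtain ⟨A, hnil, hparent, hbranch, hisol⟩ := exists_tree_isolated_leaves hn hinj hlim
  have hinitial : ∀ t s : List ℕ, s ++ t ∈ A → s ∈ A := by
    intro t
    induction t using List.reverseRecOn with
    | nil => simp
    | append_singleton t m ih =>
      intro s h
      exact ih s (hparent _ m (by simpa using h))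
  have hleaf : ∀ k (s : List ℕ), s ∈ A → s.length + k = n →
      ∃ x : Fin n → ℕ, List.ofFn x ∈ A ∧ s <+: List.ofFn x := by
    intro k
    induction k with
    | zero =>
      intro s hs hk
      obtain ⟨x, rfl⟩ := hofFn s hk
      exact ⟨x, hs, List.prefix_rfl⟩
    | succ k ih =>
      intro s hs hk
      obtain ⟨m, -, hm⟩ := hbranch s hs (by omega) 0
      obtain ⟨x, hx, hsx⟩ := ih (s ++ [m]) hm (by simp; omega)
      exact ⟨x, hx, (List.prefix_append s [m]).trans hsx⟩
  refine ⟨{x | List.ofFn x ∈ A}, ⟨?_, ?_⟩, ?_⟩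
  · obtain ⟨x, hx, -⟩ := hleaf n [] hnil (by simp)
    exact ⟨x, hx⟩
  · intro x hx i
    have hlen : ((List.ofFn x).take i).length = i := by simp
    have hmem : (List.ofFn x).take i ∈ A :=
      hinitial ((List.ofFn x).drop i) _ (by rwa [List.take_append_drop])
    refine ⟨{m | (List.ofFn x).take i ++ [m] ∈ A}, ?_, ?_⟩
    · refine Set.infinite_of_forall_exists_gt fun k => ?_
      obtain ⟨m, hkm, hm⟩ := hbranch _ hmem (by rw [hlen]; exact i.2) (k + 1)
      exact ⟨m, hm, hkm⟩
    · intro m hm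
      obtain ⟨y, hy, hpre⟩ := hleaf (n - (i + 1)) _ hm
        (by rw [List.length_append, hlen, List.length_singleton]; omega)
      refine ⟨y, hy, fun j hj => ?_, ?_⟩
      · have := hpre.getElem (i := j) (by rw [List.length_append, hlen]; omega)
        rw [List.getElem_append_left (by omega)] at this
        simpa using this.symm
      · have := hpre.getElem (i := i) (by simp)
        rw [List.getElem_append_right (by omega)] at this
        simpa using this.symm
  · rintro _ ⟨x, hx, rfl⟩
    obtain ⟨U, hU, hxU, hUx⟩ := hisol _ hx List.length_ofFn
    refine ⟨U, hU, Set.eq_singleton_iff_unique_mem.2 ⟨⟨hGofFn x ▸ hxU, x, hx, rfl⟩, ?_⟩⟩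
    rintro _ ⟨hyU, y, hy, rfl⟩
    rw [← hGofFn, ← hGofFn, hUx _ hy List.length_ofFn ((hGofFn y).symm ▸ hyU)]
end

section
/- Let n ∈ ℕ, let A ⊆ ℕ be infinite, and for each m ∈ A let T_m be a full subset of ℕ^n. Then the set {x ∈ ℕ^{n+1} : x(0) ∈ A and the sequence (x(1),…,x(n)) belongs to T_{x(0)}} is a full subset of ℕ^{n+1}. -/
theorem full_subset_amalgamation (n : ℕ) (A : Set ℕ) (hA : A.Infinite)
    (T : ℕ → Set (Fin n → ℕ)) (hT : ∀ m ∈ A, IsFullSubset n (T m)) :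
    IsFullSubset (n + 1) {x : Fin (n + 1) → ℕ | x 0 ∈ A ∧ Fin.tail x ∈ T (x 0)} := by
  have cons_mem : ∀ m ∈ A, ∀ y ∈ T m, (Fin.cons m y : Fin (n + 1) → ℕ) ∈
      {x : Fin (n + 1) → ℕ | x 0 ∈ A ∧ Fin.tail x ∈ T (x 0)} := by
    intro m hm y hy
    exact ⟨by simpa using hm, by simpa using hy⟩
  refine ⟨?_, ?_⟩
  · obtain ⟨m, hm⟩ := hA.nonempty
    obtain ⟨y, hy⟩ := (hT m hm).1
    exact ⟨_, cons_mem m hm y hy⟩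
  · rintro x ⟨hx0, hx⟩ i
    induction i using Fin.cases with
    | zero =>
      refine ⟨A, hA, fun m hm => ?_⟩
      obtain ⟨y, hy⟩ := (hT m hm).1
      exact ⟨_, cons_mem m hm y hy, fun j hj => absurd hj (by simp), by simp⟩
    | succ i =>
      obtain ⟨B, hB, h⟩ := (hT _ hx0).2 _ hx i
      refine ⟨B, hB, fun m hm => ?_⟩
      obtain ⟨y, hy, hyx, hyi⟩ := h m hm
      refine ⟨_, cons_mem _ hx0 y hy, fun j hj => ?_, by simpa using hyi⟩
      induction j using Fin.cases with
      | zero => simp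
      | succ j => simpa [Fin.tail] using hyx j (by simpa using hj)
end

section
/- Let (T_i)_{i∈ℕ} be a sequence of superperfect trees such that for every i: T_{i+1} ⊆ T_i and the canonical bijections θ_{T_{i+1}} and θ_{T_i} agree on all sequences in ℕ^{<ω} of length at most i. Then T = ⋂_{i∈ℕ} T_i is a superperfect tree, and for every i the canonical bijection θ_T agrees with θ_{T_i} on all sequences of length at most i. -/
/-- A tree is a set of finite sequences of naturals closed under initial segments. -/
def IsTree (T : Set (List ℕ)) : Prop := ∀ t ∈ T, ∀ s : List ℕ, s <+: t → s ∈ T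

/-- `treeBeta T` is the set of nodes of `T` with infinitely many immediate successors in `T`. -/
def treeBeta (T : Set (List ℕ)) : Set (List ℕ) :=
  {t ∈ T | {n : ℕ | t ++ [n] ∈ T}.Infinite}

/-- A tree is superperfect if it is a nonempty tree, every node extends to an
infinitely-branching node, and every node has either exactly one or infinitely
many immediate successors. -/
def IsSuperperfect (T : Set (List ℕ)) : Prop :=
  IsTree T ∧ T.Nonempty ∧ (∀ t ∈ T, ∃ s ∈ treeBeta T, t <+: s) ∧
    ∀ t ∈ T, ({n : ℕ | t ++ [n] ∈ T}.Infinite ∨ ∃ m : ℕ, {n : ℕ | t ++ [n] ∈ T} = {m})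

/-- Lexicographic order on finite sequences of naturals: `s ≤lex t` iff `s` is an
initial segment of `t`, or at the least position `i` where they differ (both defined),
`s i < t i`. -/
def LexLE (s t : List ℕ) : Prop :=
  s <+: t ∨ ∃ i : ℕ, i < s.length ∧ i < t.length ∧ s.take i = t.take i ∧ s.getD i 0 < t.getD i 0

/-- `θ` is a canonical bijection of `ℕ^{<ω}` onto `treeBeta T`: a bijection preserving
and reflecting both the initial-segment relation and the lexicographic order. -/
def IsCanonicalTheta (T : Set (List ℕ)) (θ : List ℕ → List ℕ) : Prop :=
  Function.Injective θ ∧ Set.range θ = treeBeta T ∧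
  (∀ s t : List ℕ, s <+: t ↔ θ s <+: θ t) ∧ (∀ s t : List ℕ, LexLE s t ↔ LexLE (θ s) (θ t))

theorem List.IsPrefix.exists_append_singleton_prefix {α : Type*} {s t : List α}
    (h : s <+: t) (hne : s ≠ t) : ∃ a, s ++ [a] <+: t := by
  obtain ⟨r, rfl⟩ := h
  cases r with
  | nil => simp at hne
  | cons a r => exact ⟨a, r, by simp⟩

theorem List.IsPrefix.eq_append_singleton {α : Type*} {s u : List α} {a : α}
    (hsu : s <+: u) (hne : s ≠ u) (hu : u <+: s ++ [a]) : u = s ++ [a] := by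
  rcases List.prefix_concat_iff.1 hu with h | h
  · exact h
  · exact absurd (hsu.eq_of_length_le h.length_le) hne

theorem List.append_singleton_prefix_append_singleton {α : Type*} {s : List α} {a b : α} :
    s ++ [a] <+: s ++ [b] ↔ a = b := by
  rw [List.prefix_append_right_inj]
  simp

theorem List.exists_splitting {α : Type*} (a b : List α) (hab : ¬ a <+: b) (hba : ¬ b <+: a) :
    ∃ c x y, x ≠ y ∧ c ++ [x] <+: a ∧ c ++ [y] <+: b := by
  induction a generalizing b with
  | nil => simp at hab
  | cons x a ih =>
    cases b with
    | nil => simp at hba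
    | cons y b =>
      by_cases hxy : x = y
      · subst hxy
        obtain ⟨c, u, v, huv, hu, hv⟩ := ih b (by simpa using hab) (by simpa using hba)
        exact ⟨x :: c, u, v, huv, by simpa using hu, by simpa using hv⟩
      · exact ⟨[], x, y, hxy, by simp, by simp⟩

theorem List.exists_splitting_above {α : Type*} {p a b : List α} (hpa : p <+: a) (hpb : p <+: b)
    (hab : ¬ a <+: b) (hba : ¬ b <+: a) :
    ∃ c x y, p <+: c ∧ x ≠ y ∧ c ++ [x] <+: a ∧ c ++ [y] <+: b := by
  obtain ⟨a, rfl⟩ := hpa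
  obtain ⟨b, rfl⟩ := hpb
  rw [List.prefix_append_right_inj] at hab hba
  obtain ⟨c, x, y, hxy, hx, hy⟩ := List.exists_splitting a b hab hba
  refine ⟨p ++ c, x, y, List.prefix_append _ _, hxy, ?_, ?_⟩
  · rwa [List.append_assoc, List.prefix_append_right_inj]
  · rwa [List.append_assoc, List.prefix_append_right_inj]

theorem lexLE_append_singleton {s : List ℕ} {a b : ℕ} :
    LexLE (s ++ [a]) (s ++ [b]) ↔ a ≤ b := by
  constructor
  · rintro (h | ⟨i, hi, -, -, hlt⟩)
    · exact (List.append_singleton_prefix_append_singleton.1 h).le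
    · rcases Nat.lt_or_ge i s.length with h | h
      · simp [List.getD_eq_getElem?_getD, List.getElem?_append_left h] at hlt
      · obtain rfl : i = s.length := by simp at hi; omega
        simp at hlt
        exact hlt.le
  · intro h
    rcases h.eq_or_lt with rfl | h
    · exact Or.inl List.prefix_rfl
    · exact Or.inr ⟨s.length, by simp, by simp, by simp, by simpa using h⟩

/-- An automorphism of `ℕ^{<ω}` for the initial-segment and lexicographic orders is the identity. -/
theorem eq_id_of_prefix_lexLE_iff {g : List ℕ → List ℕ} (hinj : Function.Injective g)
    (hsurj : Function.Surjective g) (hpre : ∀ s t, s <+: t ↔ g s <+: g t)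
    (hlex : ∀ s t, LexLE s t ↔ LexLE (g s) (g t)) (s : List ℕ) : g s = s := by
  induction s using List.reverseRecOn with
  | nil =>
    obtain ⟨u, hu⟩ := hsurj []
    have h := (hpre [] u).1 List.nil_prefix
    rw [hu] at h
    exact List.prefix_nil.1 h
  | append_singleton s n ih =>
    have hstep : ∀ n, ∃ m, g (s ++ [n]) = s ++ [m] := by
      intro n
      have h1 : s <+: g (s ++ [n]) := by
        have := (hpre s (s ++ [n])).1 (List.prefix_append _ _)
        rwa [ih] at this
      have h2 : s ≠ g (s ++ [n]) := by
        intro h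
        have := hinj (ih.trans h)
        simp at this
      obtain ⟨m, hm⟩ := h1.exists_append_singleton_prefix h2
      obtain ⟨u, hu⟩ := hsurj (s ++ [m])
      have h3 : u <+: s ++ [n] := by rw [hpre, hu]; exact hm
      have h4 : s <+: u := by rw [hpre, hu, ih]; exact List.prefix_append _ _
      have h5 : s ≠ u := by
        rintro rfl
        rw [ih] at hu
        simp at hu
      refine ⟨m, ?_⟩
      rw [← h4.eq_append_singleton h5 h3, hu]
    choose f hf using hstep
    have hmono : StrictMono f := by
      refine Monotone.strictMono_of_injective (fun a b hab => ?_) (fun a b hab => ?_)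
      · have h := (hlex (s ++ [a]) (s ++ [b])).1 (lexLE_append_singleton.2 hab)
        rw [hf, hf] at h
        exact lexLE_append_singleton.1 h
      · have : g (s ++ [a]) = g (s ++ [b]) := by rw [hf, hf, hab]
        simpa using hinj this
    have hfsurj : Function.Surjective f := by
      intro m
      obtain ⟨u, hu⟩ := hsurj (s ++ [m])
      have h4 : s <+: u := by rw [hpre, hu, ih]; exact List.prefix_append _ _
      have h5 : s ≠ u := by
        rintro rfl
        rw [ih] at hu
        simp at hu
      obtain ⟨k, hk⟩ := h4.exists_append_singleton_prefix h5
      rw [hpre, hf, hu] at hk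
      exact ⟨k, List.append_singleton_prefix_append_singleton.1 hk⟩
    have hid : f = id := (hmono.range_inj strictMono_id).1 (by simp [hfsurj.range_eq])
    rw [hf, hid, id]

namespace IsCanonicalTheta

variable {T : Set (List ℕ)} {θ θ' : List ℕ → List ℕ}

theorem mem_treeBeta (h : IsCanonicalTheta T θ) (s : List ℕ) : θ s ∈ treeBeta T :=
  h.2.1 ▸ Set.mem_range_self s

theorem exists_eq (h : IsCanonicalTheta T θ) {t : List ℕ} (ht : t ∈ treeBeta T) :
    ∃ s, θ s = t := by
  rw [← h.2.1] at ht
  exact ht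

theorem unique (h : IsCanonicalTheta T θ) (h' : IsCanonicalTheta T θ') : θ = θ' := by
  choose g hg using fun s => h'.exists_eq (h.mem_treeBeta s)
  have hid : ∀ s, g s = s := by
    refine eq_id_of_prefix_lexLE_iff (fun s t hst => ?_) (fun t => ?_) (fun s t => ?_)
      (fun s t => ?_)
    · exact h.1 (by rw [← hg, ← hg, hst])
    · obtain ⟨s, hs⟩ := h.exists_eq (h'.mem_treeBeta t)
      exact ⟨s, h'.1 (by rw [hg, hs])⟩
    · rw [h.2.2.1, h'.2.2.1 (g s), hg, hg]
    · rw [h.2.2.2, h'.2.2.2 (g s), hg, hg]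
  funext s
  rw [← hg, hid]

theorem apply_ne_apply_append (h : IsCanonicalTheta T θ) (s : List ℕ) (n : ℕ) :
    θ s ≠ θ (s ++ [n]) := by
  intro he
  simpa using h.1 he

theorem apply_prefix_apply_append (h : IsCanonicalTheta T θ) (s : List ℕ) (n : ℕ) :
    θ s <+: θ (s ++ [n]) :=
  (h.2.2.1 _ _).1 (List.prefix_append _ _)

theorem length_le (h : IsCanonicalTheta T θ) (s : List ℕ) : s.length ≤ (θ s).length := by
  induction s using List.reverseRecOn with
  | nil => simp
  | append_singleton s n ih =>
    have hp := h.apply_prefix_apply_append s n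
    have hlt : (θ s).length < (θ (s ++ [n])).length :=
      lt_of_le_of_ne hp.length_le fun he => h.apply_ne_apply_append s n (hp.eq_of_length he)
    simp only [List.length_append, List.length_singleton]
    omega

/-- Distinct immediate successors of `s` are sent through distinct immediate successors of `θ s`. -/
theorem exists_injective (hT : IsSuperperfect T) (h : IsCanonicalTheta T θ) (s : List ℕ) :
    ∃ m : ℕ → ℕ, Function.Injective m ∧ ∀ n, θ s ++ [m n] <+: θ (s ++ [n]) := by
  choose m hm using fun n =>
    (h.apply_prefix_apply_append s n).exists_append_singleton_prefix (h.apply_ne_apply_append s n)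
  refine ⟨m, fun n k hnk => ?_, hm⟩
  by_contra hne
  have hk := hm k
  rw [← hnk] at hk
  obtain ⟨c, x, y, hc, hxy, hx, hy⟩ := List.exists_splitting_above (hm n) hk
    (fun hp => hne (List.append_singleton_prefix_append_singleton.1 ((h.2.2.1 _ _).2 hp)))
    (fun hp => hne (List.append_singleton_prefix_append_singleton.1 ((h.2.2.1 _ _).2 hp)).symm)
  have hxT : c ++ [x] ∈ T := hT.1 _ (h.mem_treeBeta _).1 _ hx
  have hyT : c ++ [y] ∈ T := hT.1 _ (h.mem_treeBeta _).1 _ hy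
  have hcT : c ∈ T := hT.1 _ hxT _ (List.prefix_append _ _)
  have hcb : c ∈ treeBeta T := by
    refine ⟨hcT, (hT.2.2.2 c hcT).resolve_right ?_⟩
    rintro ⟨z, hz⟩
    have h1 : x ∈ ({z} : Set ℕ) := hz ▸ hxT
    have h2 : y ∈ ({z} : Set ℕ) := hz ▸ hyT
    exact hxy (h1.trans h2.symm)
  obtain ⟨u, rfl⟩ := h.exists_eq hcb
  have hsu : s <+: u := (h.2.2.1 _ _).2 ((List.prefix_append _ _).trans hc)
  have hsne : s ≠ u := by
    rintro rfl
    simpa using hc.length_le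
  have h1 := hsu.eq_append_singleton hsne
    ((h.2.2.1 u (s ++ [n])).2 ((List.prefix_append _ _).trans hx))
  have h2 := hsu.eq_append_singleton hsne
    ((h.2.2.1 u (s ++ [k])).2 ((List.prefix_append _ _).trans hy))
  exact hne (by simpa using h1.symm.trans h2)

end IsCanonicalTheta

theorem treeBeta_mono {S T : Set (List ℕ)} (h : S ⊆ T) : treeBeta S ⊆ treeBeta T :=
  fun _ ht => ⟨h ht.1, ht.2.mono fun _ hn => h hn⟩

theorem superperfect_fusion (T : ℕ → Set (List ℕ)) (hT : ∀ i, IsSuperperfect (T i))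
    (hsub : ∀ i, T (i + 1) ⊆ T i)
    (θ : ℕ → List ℕ → List ℕ) (hθ : ∀ i, IsCanonicalTheta (T i) (θ i))
    (hagree : ∀ i, ∀ s : List ℕ, s.length ≤ i → θ (i + 1) s = θ i s) :
    IsSuperperfect (⋂ i, T i) ∧
    ∀ θ' : List ℕ → List ℕ, IsCanonicalTheta (⋂ i, T i) θ' →
      ∀ i, ∀ s : List ℕ, s.length ≤ i → θ' s = θ i s := by
  have hanti : Antitone T := antitone_nat_of_succ_le hsub
  obtain ⟨φ, hφ⟩ : ∃ φ : List ℕ → List ℕ, ∀ i s, s.length ≤ i → θ i s = φ s := by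
    refine ⟨fun s => θ s.length s, fun i s hs => ?_⟩
    induction i, hs using Nat.le_induction with
    | base => rfl
    | succ i hi ih => rw [hagree i s hi, ih]
  have htree : IsTree (⋂ i, T i) := fun t ht s hs =>
    Set.mem_iInter.2 fun i => (hT i).1 t (Set.mem_iInter.1 ht i) s hs
  have hφT : ∀ s, φ s ∈ ⋂ i, T i := fun s => Set.mem_iInter.2 fun i => by
    rw [← hφ (max i s.length) s (le_max_right _ _)]
    exact hanti (le_max_left _ _) ((hθ _).mem_treeBeta s).1
  have hφβ : ∀ s, φ s ∈ treeBeta (⋂ i, T i) := fun s => by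
    obtain ⟨m, hm, hm'⟩ := (hθ (s.length + 1)).exists_injective (hT _) s
    refine ⟨hφT s, (Set.infinite_range_of_injective hm).mono ?_⟩
    rintro _ ⟨n, rfl⟩
    refine htree _ (hφT (s ++ [n])) _ ?_
    rw [← hφ (s.length + 1) s (by simp), ← hφ (s.length + 1) (s ++ [n]) (by simp)]
    exact hm' n
  have hφ_of_mem : ∀ t, t ∈ treeBeta (T t.length) → ∃ s, φ s = t := fun t ht => by
    obtain ⟨s, hs⟩ := (hθ _).exists_eq ht
    have hle := (hθ t.length).length_le s
    rw [hs] at hle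
    exact ⟨s, by rw [← hφ _ s hle, hs]⟩
  have hφ_above : ∀ t ∈ ⋂ i, T i, ∃ s, t <+: φ s := fun t ht => by
    obtain ⟨b, hb, htb⟩ := (hT t.length).2.2.1 t (Set.mem_iInter.1 ht _)
    obtain ⟨s, rfl⟩ := (hθ _).exists_eq hb
    rcases le_total s.length t.length with hs | hs
    · exact ⟨s, by rwa [← hφ _ s hs]⟩
    · have hlen : (s.take t.length).length = t.length := by simpa using hs
      refine ⟨s.take t.length, ?_⟩
      rw [← hφ t.length _ hlen.le]
      refine List.prefix_of_prefix_length_le htb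
        (((hθ _).2.2.1 _ _).1 (List.take_prefix _ _)) ?_
      exact hlen.ge.trans ((hθ _).length_le _)
  have hφcan : IsCanonicalTheta (⋂ i, T i) φ := by
    refine ⟨fun s t hst => ?_, ?_, fun s t => ?_, fun s t => ?_⟩
    · rw [← hφ (max s.length t.length) s (le_max_left _ _),
        ← hφ (max s.length t.length) t (le_max_right _ _)] at hst
      exact (hθ _).1 hst
    · refine Set.Subset.antisymm (Set.range_subset_iff.2 hφβ) fun t ht => ?_
      exact hφ_of_mem t (treeBeta_mono (Set.iInter_subset _ _) ht)
    · rw [← hφ (max s.length t.length) s (le_max_left _ _),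
        ← hφ (max s.length t.length) t (le_max_right _ _)]
      exact (hθ _).2.2.1 s t
    · rw [← hφ (max s.length t.length) s (le_max_left _ _),
        ← hφ (max s.length t.length) t (le_max_right _ _)]
      exact (hθ _).2.2.2 s t
  refine ⟨⟨htree, ⟨φ [], hφT []⟩, fun t ht => ?_, fun t ht => ?_⟩, fun θ' hθ' i s hs => ?_⟩
  · obtain ⟨s, hs⟩ := hφ_above t ht
    exact ⟨φ s, hφβ s, hs⟩
  · have htT := Set.mem_iInter.1 ht t.length
    rcases (hT t.length).2.2.2 t htT with hinf | ⟨m, hm⟩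
    · obtain ⟨s, rfl⟩ := hφ_of_mem t ⟨htT, hinf⟩
      exact Or.inl (hφβ s).2
    · have hss : {n : ℕ | t ++ [n] ∈ ⋂ i, T i} ⊆ {m} :=
        hm ▸ fun n hn => Set.mem_iInter.1 hn t.length
      obtain ⟨s, hs⟩ := hφ_above t ht
      have hne : t ≠ φ s := by
        rintro rfl
        exact (hφβ s).2 ((Set.finite_singleton m).subset hss)
      obtain ⟨n, hn⟩ := hs.exists_append_singleton_prefix hne
      exact Or.inr ⟨m, (Set.Nonempty.subset_singleton_iff ⟨n, htree _ (hφT s) _ hn⟩).1 hss⟩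
  · rw [hθ'.unique hφcan, hφ i s hs]
end

section
/- Let T be a superperfect tree and let F : [T] → ℝ be a continuous function such that for every t ∈ T the image under F of the cone {f ∈ [T] : t is an initial segment of f} is uncountable. Then there exists a superperfect tree S ⊆ T such that the restriction of F to [S] is injective and is a homeomorphism of [S] onto its image F''[S]. -/
/-- `branchSet T` is the set `[T]` of branches of `T`, i.e. functions all of whose
finite initial segments lie in `T`. -/
def branchSet (T : Set (List ℕ)) : Set (ℕ → ℕ) :=
  {f : ℕ → ℕ | ∀ n : ℕ, (List.range n).map f ∈ T}

/-- A restriction of `x` of length `m` is a prefix of any longer restriction. -/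
theorem map_range_prefix (x : ℕ → ℕ) {m n : ℕ} (h : m ≤ n) :
    (List.range m).map x <+: (List.range n).map x := by
  obtain ⟨d, rfl⟩ := Nat.exists_eq_add_of_le h
  rw [List.range_add, List.map_append]
  exact List.prefix_append _ _

theorem map_range_length_eq_of_prefix {x : ℕ → ℕ} {t : List ℕ} {n : ℕ}
    (h : t <+: (List.range n).map x) : (List.range t.length).map x = t := by
  have hn : t.length ≤ n := by simpa using h.length_le
  exact (List.prefix_of_prefix_length_le (map_range_prefix x hn) h (by simp)).eq_of_length
    (by simp)

theorem apply_eq_of_append_singleton_prefix {x : ℕ → ℕ} {t : List ℕ} {a n : ℕ}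
    (h : t ++ [a] <+: (List.range n).map x) : x t.length = a := by
  have h' := map_range_length_eq_of_prefix h
  rw [List.length_append, List.length_singleton, List.range_succ, List.map_append] at h'
  simpa using (List.append_inj' h' (by simp)).2

theorem eq_of_append_singleton_prefix {s l : List ℕ} {a b : ℕ}
    (ha : s ++ [a] <+: l) (hb : s ++ [b] <+: l) : a = b := by
  have h := (List.prefix_of_prefix_length_le ha hb (by simp)).eq_of_length (by simp)
  simpa using h

/-- If two sequences diverge right after `s` and right after `t`, then `s = t`. -/
theorem eq_of_diverge {s t l₁ l₂ : List ℕ} {a b c d : ℕ} (hab : a ≠ b) (hcd : c ≠ d)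
    (h₁ : s ++ [a] <+: l₁) (h₂ : s ++ [b] <+: l₂)
    (h₃ : t ++ [c] <+: l₁) (h₄ : t ++ [d] <+: l₂) : s = t := by
  have ht₁ := (List.prefix_append t [c]).trans h₃
  have ht₂ := (List.prefix_append t [d]).trans h₄
  have hs₁ := (List.prefix_append s [a]).trans h₁
  have hs₂ := (List.prefix_append s [b]).trans h₂
  rcases lt_trichotomy s.length t.length with h | h | h
  · exact absurd (eq_of_append_singleton_prefix
      (List.prefix_of_prefix_length_le h₁ ht₁ (by simpa using h))
      (List.prefix_of_prefix_length_le h₂ ht₂ (by simpa using h))) hab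
  · exact (List.prefix_of_prefix_length_le hs₁ ht₁ h.le).eq_of_length h
  · exact absurd (eq_of_append_singleton_prefix
      (List.prefix_of_prefix_length_le h₃ hs₁ (by simpa using h))
      (List.prefix_of_prefix_length_le h₄ hs₂ (by simpa using h))) hcd

/-- The tree of initial segments of the labels of all states reachable from `p`. -/
def schemeTree {α : Type*} (t : α → List ℕ) (next : α → ℕ → α) (p : α) : Set (List ℕ) :=
  {s | ∃ σ : List ℕ, s <+: t (σ.foldl next p)}

section Scheme

variable {α : Type*} {t : α → List ℕ} {next : α → ℕ → α} {k : α → ℕ → ℕ}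

theorem prefix_foldl_next (hpre : ∀ p n, t p ++ [k p n] <+: t (next p n)) (p : α) (σ : List ℕ) :
    t p <+: t (σ.foldl next p) := by
  induction σ generalizing p with
  | nil => exact List.prefix_refl _
  | cons n σ ih => exact ((List.prefix_append _ _).trans (hpre p n)).trans (ih _)

theorem append_prefix_foldl_next (hpre : ∀ p n, t p ++ [k p n] <+: t (next p n)) (p : α)
    (n : ℕ) (σ : List ℕ) : t p ++ [k p n] <+: t ((n :: σ).foldl next p) :=
  (hpre p n).trans (prefix_foldl_next hpre _ σ)

theorem exists_eq_foldl_of_branching (hk : ∀ p, Function.Injective (k p))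
    (hpre : ∀ p n, t p ++ [k p n] <+: t (next p n)) {s : List ℕ} {a b : ℕ} (hab : a ≠ b)
    (p : α) (σ τ : List ℕ) (ha : s ++ [a] <+: t (σ.foldl next p))
    (hb : s ++ [b] <+: t (τ.foldl next p)) : ∃ ρ : List ℕ, s = t (ρ.foldl next p) := by
  induction σ generalizing p τ with
  | nil =>
    exact absurd (eq_of_append_singleton_prefix (ha.trans (prefix_foldl_next hpre p τ)) hb) hab
  | cons n σ ih =>
    cases τ with
    | nil =>
      exact absurd
        (eq_of_append_singleton_prefix ha (hb.trans (prefix_foldl_next hpre p (n :: σ)))) hab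
    | cons m τ =>
      by_cases hnm : n = m
      · subst hnm
        obtain ⟨ρ, hρ⟩ := ih (next p n) τ ha hb
        exact ⟨n :: ρ, hρ⟩
      · exact ⟨[], eq_of_diverge hab ((hk p).ne hnm) ha hb
          (append_prefix_foldl_next hpre p n σ) (append_prefix_foldl_next hpre p m τ)⟩

theorem infinite_succ_schemeTree (hk : ∀ p, Function.Injective (k p))
    (hpre : ∀ p n, t p ++ [k p n] <+: t (next p n)) (p : α) (σ : List ℕ) :
    {n : ℕ | t (σ.foldl next p) ++ [n] ∈ schemeTree t next p}.Infinite := by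
  refine (Set.infinite_range_of_injective (hk (σ.foldl next p))).mono ?_
  rintro _ ⟨n, rfl⟩
  exact ⟨σ ++ [n], by simpa using hpre (σ.foldl next p) n⟩

theorem isSuperperfect_schemeTree (hk : ∀ p, Function.Injective (k p))
    (hpre : ∀ p n, t p ++ [k p n] <+: t (next p n)) (p : α) :
    IsSuperperfect (schemeTree t next p) := by
  refine ⟨fun s ⟨σ, hσ⟩ u hu => ⟨σ, hu.trans hσ⟩, ⟨t p, [], List.prefix_refl _⟩, ?_, ?_⟩
  · rintro s ⟨σ, hσ⟩
    exact ⟨_, ⟨⟨σ, List.prefix_refl _⟩, infinite_succ_schemeTree hk hpre p σ⟩, hσ⟩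
  · rintro s ⟨σ, hσ⟩
    by_cases hs : ∃ ρ : List ℕ, s = t (ρ.foldl next p)
    · obtain ⟨ρ, rfl⟩ := hs
      exact Or.inl (infinite_succ_schemeTree hk hpre p ρ)
    · refine Or.inr ?_
      obtain ⟨_ | ⟨a, r⟩, hr⟩ := hσ
      · exact absurd ⟨σ, by simpa using hr⟩ hs
      · have ha : s ++ [a] <+: t (σ.foldl next p) := ⟨r, by simpa using hr⟩
        refine ⟨a, Set.eq_singleton_iff_unique_mem.2 ⟨⟨σ, ha⟩, ?_⟩⟩
        rintro b ⟨τ, hb⟩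
        by_contra hba
        exact hs (exists_eq_foldl_of_branching hk hpre hba p τ σ hb ha)

theorem map_range_eq_of_mem_branchSet_schemeTree
    (hpre : ∀ p n, t p ++ [k p n] <+: t (next p n)) {p : α} {x : ℕ → ℕ}
    (hx : x ∈ branchSet (schemeTree t next p)) : (List.range (t p).length).map x = t p := by
  obtain ⟨σ, hσ⟩ := hx (t p).length
  exact (List.prefix_of_prefix_length_le hσ (prefix_foldl_next hpre p σ) (by simp)).eq_of_length
    (by simp)

theorem exists_mem_branchSet_schemeTree_next (hk : ∀ p, Function.Injective (k p))
    (hpre : ∀ p n, t p ++ [k p n] <+: t (next p n)) {p : α} {x : ℕ → ℕ}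
    (hx : x ∈ branchSet (schemeTree t next p)) :
    ∃ n, x ∈ branchSet (schemeTree t next (next p n)) := by
  have key : ∀ m, (t p).length + 1 ≤ m → ∃ n, x (t p).length = k p n ∧
      (List.range m).map x ∈ schemeTree t next (next p n) := by
    intro m hm
    obtain ⟨_ | ⟨n, σ⟩, hσ⟩ := hx m
    · have := hσ.length_le
      simp at this
      omega
    · exact ⟨n, apply_eq_of_append_singleton_prefix (List.prefix_of_prefix_length_le
        (append_prefix_foldl_next hpre p n σ) hσ (by simpa using hm)), σ, hσ⟩
  obtain ⟨n, hn, -⟩ := key _ le_rfl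
  refine ⟨n, fun m => ?_⟩
  obtain ⟨n', hn', σ, hσ⟩ := key (m + ((t p).length + 1)) (Nat.le_add_left _ _)
  obtain rfl := hk p (hn.symm.trans hn')
  exact ⟨σ, (map_range_prefix x (Nat.le_add_right _ _)).trans hσ⟩

/-- If the images of sibling cones are separated by disjoint open sets, then nearby values of `F`
on the branches of the scheme come from branches with long common initial segments. -/
theorem exists_isOpen_forall_branch_eq (hk : ∀ p, Function.Injective (k p))
    (hpre : ∀ p n, t p ++ [k p n] <+: t (next p n)) {Y : Type*} [TopologicalSpace Y]
    {U : α → Set Y} {F : (ℕ → ℕ) → Y} (hU : ∀ p, IsOpen (U p))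
    (hdisj : ∀ p, Pairwise fun m n => Disjoint (U (next p m)) (U (next p n)))
    (hF : ∀ p, ∀ x ∈ branchSet (schemeTree t next p), F x ∈ U p) (N : ℕ) (p : α) (x : ℕ → ℕ)
    (hx : x ∈ branchSet (schemeTree t next p)) :
    ∃ V : Set Y, IsOpen V ∧ F x ∈ V ∧ ∀ y ∈ branchSet (schemeTree t next p), F y ∈ V →
      ∀ i < (t p).length + N, y i = x i := by
  induction N generalizing p with
  | zero =>
    refine ⟨Set.univ, isOpen_univ, trivial, fun y hy _ i hi => ?_⟩
    have h := (map_range_eq_of_mem_branchSet_schemeTree hpre hy).trans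
      (map_range_eq_of_mem_branchSet_schemeTree hpre hx).symm
    exact List.map_inj_left.1 h i (List.mem_range.2 hi)
  | succ N ih =>
    obtain ⟨n, hn⟩ := exists_mem_branchSet_schemeTree_next hk hpre hx
    obtain ⟨V, hV, hxV, hyV⟩ := ih (next p n) hn
    refine ⟨V ∩ U (next p n), hV.inter (hU _), ⟨hxV, hF _ x hn⟩, fun y hy hFy i hi => ?_⟩
    obtain ⟨m, hm⟩ := exists_mem_branchSet_schemeTree_next hk hpre hy
    have hmn : m = n := by
      by_contra hne
      exact Set.disjoint_left.1 (hdisj p hne) (hF _ y hm) hFy.2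
    subst hmn
    refine hyV y hm hFy.1 i ?_
    have := (hpre p m).length_le
    simp at this
    omega

end Scheme

/-- An injective sequence of reals has a subsequence whose terms are separated by pairwise
disjoint open sets. -/
theorem exists_subseq_pairwise_disjoint_isOpen (G : ℕ → ℝ) (hG : Function.Injective G) :
    ∃ (φ : ℕ → ℕ) (U : ℕ → Set ℝ), Function.Injective φ ∧ (∀ n, IsOpen (U n)) ∧
      Pairwise (Function.onFun Disjoint U) ∧ ∀ n, G (φ n) ∈ U n := by
  obtain ⟨g, hg⟩ := exists_increasing_or_nonincreasing_subseq (· < ·) G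
  have hinj : Function.Injective fun n => g (2 * n + 1) := fun m n h => by
    have := g.injective h
    omega
  rcases hg with hg | hg
  · have hmono : Monotone fun n => G (g (2 * n)) :=
      monotone_nat_of_le_succ fun n => (hg _ _ (by omega)).le
    exact ⟨_, _, hinj, fun n => isOpen_Ioo, hmono.pairwise_disjoint_on_Ioo_succ,
      fun n => ⟨hg _ _ (by omega), hg _ _ (by simp; omega)⟩⟩
  · have hlt : ∀ m n, m < n → G (g n) < G (g m) := fun m n h =>
      lt_of_le_of_ne (not_lt.1 (hg m n h)) fun he => h.ne' (g.injective (hG he))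
    have hanti : Antitone fun n => G (g (2 * n)) :=
      antitone_nat_of_succ_le fun n => (hlt _ _ (by omega)).le
    exact ⟨_, _, hinj, fun n => isOpen_Ioo, hanti.pairwise_disjoint_on_Ioo_succ,
      fun n => ⟨hlt _ _ (by simp; omega), hlt _ _ (by omega)⟩⟩

theorem exists_forall_mem_of_continuousOn {F : (ℕ → ℕ) → ℝ} {B : Set (ℕ → ℕ)}
    (hF : ContinuousOn F B) {x : ℕ → ℕ} (hx : x ∈ B) {U : Set ℝ} (hU : IsOpen U)
    (hxU : F x ∈ U) : ∃ N, ∀ y ∈ B, (∀ i < N, y i = x i) → F y ∈ U := by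
  obtain ⟨W, hW, hxW, hWU⟩ := mem_nhdsWithin.1 (hF x hx (hU.mem_nhds hxU))
  obtain ⟨_, ⟨z, N, rfl⟩, hxz, hzW⟩ :=
    (PiNat.isTopologicalBasis_cylinders fun _ => ℕ).exists_subset_of_mem_open hxW hW
  refine ⟨N, fun y hy h => hWU ⟨hzW fun i hi => ?_, hy⟩⟩
  rw [h i hi, hxz i hi]

/-- Above a splitting node there are infinitely many splitting nodes, extending distinct immediate
successors, whose cones have images in pairwise disjoint open sets. -/
theorem exists_splitting_extensions {T : Set (List ℕ)} (hT : IsSuperperfect T)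
    {F : (ℕ → ℕ) → ℝ} (hF : ContinuousOn F (branchSet T))
    (huncount : ∀ t ∈ T,
      ¬ (F '' {f ∈ branchSet T | (List.range t.length).map f = t}).Countable)
    {t : List ℕ} (ht : t ∈ treeBeta T) :
    ∃ (k : ℕ → ℕ) (s : ℕ → List ℕ) (U : ℕ → Set ℝ), Function.Injective k ∧
      (∀ n, t ++ [k n] <+: s n) ∧ (∀ n, s n ∈ treeBeta T) ∧ (∀ n, IsOpen (U n)) ∧
      Pairwise (Function.onFun Disjoint U) ∧
      ∀ n, ∀ x ∈ branchSet T, (List.range (s n).length).map x = s n → F x ∈ U n := by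
  obtain ⟨f, hf, hne⟩ := exists_seq_of_forall_finset_exists
    (fun q : ℕ × (ℕ → ℕ) => q.2 ∈ branchSet T ∧
      (List.range (t ++ [q.1]).length).map q.2 = t ++ [q.1])
    (fun q r => q.1 ≠ r.1 ∧ F q.2 ≠ F r.2) (by
      intro A _
      classical
      obtain ⟨k, hk, hkA⟩ := ht.2.exists_notMem_finset (A.image Prod.fst)
      have hinf : (F '' {f ∈ branchSet T |
          (List.range (t ++ [k]).length).map f = t ++ [k]}).Infinite :=
        fun h => huncount _ hk h.countable
      obtain ⟨_, ⟨x, hx, rfl⟩, hxA⟩ := hinf.exists_notMem_finset (A.image fun q => F q.2)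
      refine ⟨(k, x), hx, fun q hq => ⟨fun h => hkA ?_, fun h => hxA ?_⟩⟩
      · exact Finset.mem_image.2 ⟨q, hq, h⟩
      · exact Finset.mem_image.2 ⟨q, hq, h⟩)
  have hinj₁ : Function.Injective fun n => (f n).1 :=
    Function.Injective.of_lt_imp_ne fun m n h => (hne m n h).1
  have hinj₂ : Function.Injective fun n => F (f n).2 :=
    Function.Injective.of_lt_imp_ne fun m n h => (hne m n h).2
  obtain ⟨φ, U, hφ, hU, hdisj, hmem⟩ := exists_subseq_pairwise_disjoint_isOpen _ hinj₂
  have hs : ∀ n, ∃ s ∈ treeBeta T, t ++ [(f (φ n)).1] <+: s ∧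
      ∀ x ∈ branchSet T, (List.range s.length).map x = s → F x ∈ U n := by
    intro n
    obtain ⟨hx, hxt⟩ := hf (φ n)
    obtain ⟨N, hN⟩ := exists_forall_mem_of_continuousOn hF hx (hU n) (hmem n)
    obtain ⟨s, hs, hus⟩ := hT.2.2.1 _ (hx (N + (t ++ [(f (φ n)).1]).length))
    refine ⟨s, hs, ?_, fun y hy hys => hN y hy fun i hi => ?_⟩
    · have h := map_range_prefix (f (φ n)).2 (Nat.le_add_left (t ++ [(f (φ n)).1]).length N)
      rw [hxt] at h
      exact h.trans hus
    · rw [← hys] at hus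
      have h := map_range_length_eq_of_prefix hus
      rw [List.length_map, List.length_range] at h
      exact List.map_inj_left.1 h i (List.mem_range.2 (by omega))
  choose s hs hts hsU using hs
  exact ⟨_, s, U, hinj₁.comp hφ, hts, hs, hU, hdisj, hsU⟩

theorem superperfect_homeomorphism_onto_image (T : Set (List ℕ)) (hT : IsSuperperfect T)
    (F : (ℕ → ℕ) → ℝ) (hF : ContinuousOn F (branchSet T))
    (huncount : ∀ t ∈ T,
      ¬ (F '' {f ∈ branchSet T | (List.range t.length).map f = t}).Countable) :
    ∃ S : Set (List ℕ), IsSuperperfect S ∧ S ⊆ T ∧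
      Set.InjOn F (branchSet S) ∧ Topology.IsEmbedding ((branchSet S).restrict F) := by
  let α := {p : List ℕ × Set ℝ // p.1 ∈ treeBeta T ∧ IsOpen p.2 ∧
    ∀ x ∈ branchSet T, (List.range p.1.length).map x = p.1 → F x ∈ p.2}
  let t : α → List ℕ := fun p => p.1.1
  choose k s U hk hpre hs hU hdisj hsU using
    fun p : α => exists_splitting_extensions hT hF huncount p.2.1
  let next : α → ℕ → α := fun p n => ⟨(s p n, U p n), hs p n, hU p n, hsU p n⟩
  have hpre' : ∀ p n, t p ++ [k p n] <+: t (next p n) := hpre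
  obtain ⟨t₀, ht₀⟩ := hT.2.1
  obtain ⟨s₀, hs₀, -⟩ := hT.2.2.1 t₀ ht₀
  let p₀ : α := ⟨(s₀, Set.univ), hs₀, isOpen_univ, fun _ _ _ => trivial⟩
  have hsub : ∀ p, schemeTree t next p ⊆ T := fun p u ⟨σ, hσ⟩ =>
    hT.1 _ (σ.foldl next p).2.1.1 u hσ
  have hsubB : ∀ p, branchSet (schemeTree t next p) ⊆ branchSet T :=
    fun p x hx n => hsub p (hx n)
  have key := exists_isOpen_forall_branch_eq hk hpre' (U := fun p : α => p.1.2) (F := F)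
    (fun p => p.2.2.1) (fun p m n h => hdisj p h) (fun p x hx => p.2.2.2 x (hsubB p hx)
      (map_range_eq_of_mem_branchSet_schemeTree hpre' hx))
  have hinj : Set.InjOn F (branchSet (schemeTree t next p₀)) := by
    intro x hx y hy hxy
    funext i
    obtain ⟨V, -, hV, h⟩ := key (i + 1) p₀ x hx
    exact (h y hy (hxy ▸ hV) i (by omega)).symm
  refine ⟨schemeTree t next p₀, isSuperperfect_schemeTree hk hpre' p₀, hsub p₀, hinj,
    Topology.isInducing_iff_nhds.2 fun x => le_antisymm ?_ ?_, hinj.injective⟩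
  · exact ((hF.mono (hsubB p₀)).domRestrict.tendsto x).le_comap
  · rw [nhds_subtype_eq_comap, ← Filter.tendsto_iff_comap, tendsto_pi_nhds]
    intro i
    obtain ⟨V, hVo, hV, h⟩ := key (i + 1) p₀ x x.2
    refine tendsto_nhds_of_eventually_eq ?_
    filter_upwards [Filter.preimage_mem_comap (hVo.mem_nhds hV)] with y hy
    exact h y y.2 hy i (by omega)
end

section
/- Let n ≥ 1, let X ⊆ (ℕ^ℕ)^n be a large closed set, and let F : X → ℝ be a continuous function such that for every nonempty relatively open subset V ⊆ X, every k < n, and every x ∈ V, the image under F of the set {y ∈ V : y↾k = x↾k} is uncountable. Then there exists a large closed set X' ⊆ X such that the restriction of F to X' is injective and is a homeomorphism of X' onto its image F''X'. -/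
/-- A subset of Baire space `ℕ^ℕ` is large iff it is the set of branches of a
superperfect tree. -/
def IsLargeBase (X : Set (ℕ → ℕ)) : Prop :=
  ∃ T : Set (List ℕ), IsSuperperfect T ∧ X = branchSet T

/-- A subset of `(ℕ^ℕ)^n` (for `n ≥ 1`) is large iff its projection to the first
`n - 1` coordinates is large and all of its vertical sections over that projection
are large subsets of `ℕ^ℕ`. (For `n = 0` we make the trivial convention that only
the full space is large.) -/
def IsLarge : (n : ℕ) → Set (Fin n → (ℕ → ℕ)) → Prop
  | 0, X => X = Set.univ
  | 1, X => IsLargeBase ((fun x => x 0) '' X)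
  | (n + 2), X => IsLarge (n + 1) (Fin.init '' X) ∧
      ∀ y ∈ Fin.init '' X, IsLargeBase {g : ℕ → ℕ | Fin.snoc y g ∈ X}

namespace LargeSet

/-! ### Codes of finite sequences -/

/-- A bijective coding of finite sequences by natural numbers under which proper initial segments
receive smaller codes. -/
def code (τ : List ℕ) : ℕ := Encodable.encode τ.reverse

/-- The inverse of `code`. -/
def decode (k : ℕ) : List ℕ := (Denumerable.ofNat (List ℕ) k).reverse

@[simp] lemma decode_code (τ : List ℕ) : decode (code τ) = τ := by simp [decode, code]

@[simp] lemma code_decode (k : ℕ) : code (decode k) = k := by simp [decode, code]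

@[simp] lemma code_nil : code [] = 0 := by simp [code]

@[simp] lemma decode_zero : decode 0 = [] := by rw [← code_nil, decode_code]

lemma code_injective : Function.Injective code := Function.LeftInverse.injective decode_code

lemma code_lt_code_append (τ : List ℕ) (i : ℕ) : code τ < code (τ ++ [i]) := by
  simp only [code, List.reverse_append, List.reverse_singleton, List.singleton_append,
    Encodable.encode_list_cons]
  exact Nat.lt_succ_of_le (Nat.right_le_pair _ _)

lemma code_le_of_prefix {σ τ : List ℕ} (h : σ <+: τ) : code σ ≤ code τ := by
  obtain ⟨ρ, rfl⟩ := h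
  induction ρ using List.reverseRecOn with
  | nil => simp
  | append_singleton ρ i ih =>
    rw [← List.append_assoc]
    exact ih.trans (code_lt_code_append _ _).le

lemma code_lt_of_prefix {σ τ : List ℕ} (h : σ <+: τ) (hne : σ ≠ τ) : code σ < code τ :=
  (code_le_of_prefix h).lt_of_ne fun h' => hne (code_injective h')

lemma length_le_code (τ : List ℕ) : τ.length ≤ code τ := by
  induction τ using List.reverseRecOn with
  | nil => simp
  | append_singleton τ i ih =>
    have := code_lt_code_append τ i
    simp only [List.length_append, List.length_singleton]
    omega

lemma code_take_le (τ : List ℕ) (i : ℕ) : code (τ.take i) ≤ code τ :=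
  code_le_of_prefix (List.take_prefix _ _)

lemma code_take_lt {τ : List ℕ} {i : ℕ} (h : i < τ.length) : code (τ.take i) < code τ := by
  refine code_lt_of_prefix (List.take_prefix _ _) fun h' => ?_
  have := congrArg List.length h'
  simp at this
  omega

lemma decode_ne_nil {k : ℕ} (hk : 1 ≤ k) : decode k ≠ [] := by
  intro h
  have := code_decode k
  rw [h, code_nil] at this
  omega

lemma length_decode_pos {k : ℕ} (hk : 1 ≤ k) : 1 ≤ (decode k).length :=
  List.length_pos_iff.2 (decode_ne_nil hk)

lemma code_dropLast_lt {k : ℕ} (hk : 1 ≤ k) : code (decode k).dropLast < k := by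
  have h := length_decode_pos hk
  have := code_take_lt (τ := decode k) (i := (decode k).length - 1) (by omega)
  rwa [← List.dropLast_eq_take, code_decode] at this

/-! ### Initial segments and cylinders -/

/-- The initial segment of `y` of length `n`. -/
def pre (y : ℕ → ℕ) (n : ℕ) : List ℕ := (List.range n).map y

@[simp] lemma length_pre (y : ℕ → ℕ) (n : ℕ) : (pre y n).length = n := by simp [pre]

@[simp] lemma getElem_pre (y : ℕ → ℕ) (n i : ℕ) (h : i < (pre y n).length) :
    (pre y n)[i] = y i := by simp [pre]

@[simp] lemma pre_zero (y : ℕ → ℕ) : pre y 0 = [] := by simp [pre]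

lemma pre_succ (y : ℕ → ℕ) (n : ℕ) : pre y (n + 1) = pre y n ++ [y n] := by
  simp [pre, List.range_succ]

lemma pre_inj {y z : ℕ → ℕ} {n : ℕ} : pre y n = pre z n ↔ ∀ i < n, y i = z i := by
  constructor
  · intro h i hi
    have := List.getElem_of_eq h (i := i) (by simpa using hi)
    simpa using this
  · intro h
    apply List.ext_getElem (by simp)
    intro i h1 h2
    simpa using h i (by simpa using h1)

lemma take_pre (y : ℕ → ℕ) {m n : ℕ} (h : m ≤ n) : (pre y n).take m = pre y m := by
  apply List.ext_getElem (by simp [h])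
  intro i h1 h2
  simp

/-- The set of functions extending `s`. -/
def cyl (s : List ℕ) : Set (ℕ → ℕ) := {y | ∀ (i : ℕ) (h : i < s.length), s[i] = y i}

lemma cyl_anti {s t : List ℕ} (h : s <+: t) : cyl t ⊆ cyl s := by
  intro y hy i hi
  rw [h.getElem hi]
  exact hy i _

lemma mem_cyl_pre {y z : ℕ → ℕ} {n : ℕ} : y ∈ cyl (pre z n) ↔ ∀ i < n, y i = z i := by
  simp [cyl, eq_comm]

lemma mem_cyl_iff {y : ℕ → ℕ} {s : List ℕ} : y ∈ cyl s ↔ pre y s.length = s := by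
  constructor
  · intro h
    apply List.ext_getElem (by simp)
    intro i h1 h2
    simpa using (h i h2).symm
  · intro h i hi
    have := List.getElem_of_eq h (i := i) (by simpa using hi)
    simpa using this.symm

lemma mem_cyl_append {y : ℕ → ℕ} {s : List ℕ} {m : ℕ} :
    y ∈ cyl (s ++ [m]) ↔ y ∈ cyl s ∧ y s.length = m := by
  rw [mem_cyl_iff, mem_cyl_iff, List.length_append, List.length_singleton, pre_succ]
  simp

lemma prefix_of_mem_cyl {y : ℕ → ℕ} {s t : List ℕ} (hs : y ∈ cyl s) (ht : y ∈ cyl t)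
    (h : s.length ≤ t.length) : s <+: t := by
  rw [mem_cyl_iff] at hs ht
  rw [← hs, ← ht, ← take_pre y h]
  exact List.take_prefix _ _

lemma isOpen_cyl (s : List ℕ) : IsOpen (cyl s) := by
  have : cyl s = ⋂ i : Fin s.length, {y | s[i] = y i} := by
    ext y
    simp only [cyl, Set.mem_ofPred_eq, Set.mem_iInter]
    exact ⟨fun h i => h i i.2, fun h i hi => h ⟨i, hi⟩⟩
  rw [this]
  refine isOpen_iInter_of_finite fun i => ?_
  exact (isOpen_discrete {m : ℕ | s[i] = m}).preimage (continuous_apply (i : ℕ))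

lemma isClosed_cyl (s : List ℕ) : IsClosed (cyl s) := by
  have : cyl s = ⋂ i : Fin s.length, {y | s[i] = y i} := by
    ext y
    simp only [cyl, Set.mem_ofPred_eq, Set.mem_iInter]
    exact ⟨fun h i => h i i.2, fun h i hi => h ⟨i, hi⟩⟩
  rw [this]
  refine isClosed_iInter fun i => ?_
  exact (isClosed_discrete {m : ℕ | s[i] = m}).preimage (continuous_apply (i : ℕ))

lemma exists_cyl_pre_subset {O : Set (ℕ → ℕ)} (hO : IsOpen O) {y : ℕ → ℕ} (hy : y ∈ O) :
    ∃ K, cyl (pre y K) ⊆ O := by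
  obtain ⟨I, u, hu, hsub⟩ := isOpen_pi_iff.1 hO y hy
  refine ⟨I.sup id + 1, fun z hz => hsub fun i hi => ?_⟩
  rw [mem_cyl_pre] at hz
  have : i ≤ I.sup id := Finset.le_sup (f := id) hi
  rw [hz i (by omega)]
  exact (hu i hi).2

lemma exists_forall_mem_cyl {u : ℕ → List ℕ} (hu : ∀ k, u k <+: u (k + 1))
    (hlen : ∀ k, k ≤ (u k).length) : ∃ f : ℕ → ℕ, ∀ k, f ∈ cyl (u k) := by
  have hmono : ∀ k l, k ≤ l → u k <+: u l := fun k l hkl => by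
    induction l, hkl using Nat.le_induction with
    | base => exact List.prefix_refl _
    | succ l _ ih => exact ih.trans (hu l)
  refine ⟨fun i => (u (i + 1))[i]'(hlen (i + 1)), fun k i hi => ?_⟩
  rcases le_total k (i + 1) with h | h
  · exact (hmono _ _ h).getElem hi
  · exact ((hmono _ _ h).getElem (hlen (i + 1))).symm

/-! ### Sets that are not bounded by countably many functions -/

/-- A set of functions is unbounded if it is not covered by countably many sets of the form
`{f | f ≤ g}`. -/
def Pos (A : Set (ℕ → ℕ)) : Prop :=
  ∀ C : Set (ℕ → ℕ), C.Countable → ∃ f ∈ A, ∀ g ∈ C, ∃ i, g i < f i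

lemma Pos.mono {A B : Set (ℕ → ℕ)} (hA : Pos A) (h : A ⊆ B) : Pos B := fun C hC => by
  obtain ⟨f, hf, hg⟩ := hA C hC
  exact ⟨f, h hf, hg⟩

lemma Pos.nonempty {A : Set (ℕ → ℕ)} (hA : Pos A) : A.Nonempty := by
  obtain ⟨f, hf, -⟩ := hA ∅ Set.countable_empty
  exact ⟨f, hf⟩

lemma Pos.exists_of_subset_iUnion {ι : Type*} [Countable ι] {A : Set (ℕ → ℕ)} (hA : Pos A)
    {B : ι → Set (ℕ → ℕ)} (h : A ⊆ ⋃ i, B i) : ∃ i, Pos (B i) := by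
  by_contra! hB
  simp only [Pos, not_forall, exists_prop] at hB
  choose C hC hCB using hB
  obtain ⟨f, hf, hg⟩ := hA (⋃ i, C i) (Set.countable_iUnion hC)
  obtain ⟨i, hi⟩ := Set.mem_iUnion.1 (h hf)
  exact hCB i ⟨f, hi, fun g hgi => hg g (Set.mem_iUnion.2 ⟨i, hgi⟩)⟩

lemma exists_bound_of_forall_le (h : List ℕ → ℕ) :
    ∃ g : ℕ → ℕ, ∀ f : ℕ → ℕ, (∀ k, f k ≤ h (pre f k)) → ∀ k, f k ≤ g k := by
  have key : ∀ k, ∃ L : Finset (List ℕ), ∀ f : ℕ → ℕ, (∀ k, f k ≤ h (pre f k)) → pre f k ∈ L := by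
    intro k
    induction k with
    | zero => exact ⟨{[]}, fun f _ => by simp⟩
    | succ k ih =>
      obtain ⟨L, hL⟩ := ih
      refine ⟨L.biUnion fun s => (Finset.range (h s + 1)).image fun m => s ++ [m], fun f hf => ?_⟩
      rw [Finset.mem_biUnion]
      refine ⟨pre f k, hL f hf, ?_⟩
      rw [Finset.mem_image]
      exact ⟨f k, Finset.mem_range.2 (Nat.lt_succ_of_le (hf k)), (pre_succ f k).symm⟩
  choose L hL using key
  exact ⟨fun k => (L k).sup h, fun f hf k => (hf k).trans (Finset.le_sup (hL k f hf))⟩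

lemma Pos.exists_infinite_split {A : Set (ℕ → ℕ)} (hA : Pos A) :
    ∃ s, {m | Pos (A ∩ cyl (s ++ [m]))}.Infinite := by
  by_contra! hfin
  have hb : ∀ s, ∃ b, ∀ m, Pos (A ∩ cyl (s ++ [m])) → m ≤ b := fun s => by
    obtain ⟨b, hb⟩ := (hfin s).bddAbove
    exact ⟨b, fun m hm => hb hm⟩
  choose h hh using hb
  obtain ⟨g, hg⟩ := exists_bound_of_forall_le h
  have hcov : A ⊆ ⋃ o : Option {s : List ℕ // ¬ Pos (A ∩ cyl s)},
      o.elim {f | ∀ k, f k ≤ g k} fun s => A ∩ cyl s.1 := by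
    intro f hf
    rw [Set.mem_iUnion]
    by_cases hk : ∀ k, Pos (A ∩ cyl (pre f k))
    · refine ⟨none, hg f fun k => hh _ _ ?_⟩
      rw [← pre_succ]
      exact hk _
    · push Not at hk
      obtain ⟨k, hk⟩ := hk
      exact ⟨some ⟨_, hk⟩, hf, mem_cyl_pre.2 fun _ _ => rfl⟩
  obtain ⟨o, ho⟩ := hA.exists_of_subset_iUnion hcov
  cases o with
  | none =>
    obtain ⟨f, hf, hfg⟩ := ho {g} (Set.countable_singleton g)
    obtain ⟨i, hi⟩ := hfg g rfl
    exact absurd (hf i) (not_le.2 hi)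
  | some s => exact s.2 ho

lemma prefix_of_infinite_split {A : Set (ℕ → ℕ)} {s t : List ℕ} (hA : A ⊆ cyl t)
    (h : {m | (A ∩ cyl (s ++ [m])).Nonempty}.Infinite) : t <+: s := by
  obtain ⟨m, ⟨y, hyA, hy⟩, hm⟩ := h.exists_notMem_finset {(t[s.length]?).getD 0}
  rw [mem_cyl_append] at hy
  refine prefix_of_mem_cyl (hA hyA) hy.1 ?_
  by_contra! hlt
  have := hA hyA _ hlt
  rw [hy.2] at this
  simp [List.getElem?_eq_getElem hlt, this] at hm

lemma pos_branchSet_inter_cyl {T : Set (List ℕ)} (hT : IsSuperperfect T)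
    {t : List ℕ} (ht : t ∈ T) : Pos (branchSet T ∩ cyl t) := by
  intro C hC
  obtain ⟨g, hg⟩ : ∃ g : ℕ → ℕ → ℕ, C ⊆ Set.range g := by
    rcases C.eq_empty_or_nonempty with rfl | hne
    · exact ⟨fun _ _ => 0, Set.empty_subset _⟩
    · obtain ⟨g, rfl⟩ := hC.exists_eq_range hne
      exact ⟨g, subset_rfl⟩
  have step : ∀ (k : ℕ) (u : T), ∃ u' : T, u.1 <+: u'.1 ∧ u.1.length < u'.1.length ∧
      ∃ (i : ℕ) (h : i < u'.1.length), g k i < u'.1[i] := by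
    rintro k ⟨u, hu⟩
    obtain ⟨s, hs, hus⟩ := hT.2.2.1 u hu
    obtain ⟨m, hm, hlt⟩ := hs.2.exists_gt (g k s.length)
    have := hus.length_le
    refine ⟨⟨s ++ [m], hm⟩, hus.trans (List.prefix_append _ _), ?_, s.length, ?_, ?_⟩
    · simp; omega
    · simp
    · simpa using hlt
  choose nxt h1 h2 h3 using step
  let u : ℕ → T := fun k => Nat.rec ⟨t, ht⟩ nxt k
  have hlen : ∀ k, k ≤ (u k).1.length := by
    intro k
    induction k with
    | zero => exact Nat.zero_le _
    | succ k ih => exact lt_of_le_of_lt ih (h2 k (u k))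
  obtain ⟨f, hf⟩ := exists_forall_mem_cyl (u := fun k => (u k).1) (fun k => h1 k (u k)) hlen
  refine ⟨f, ⟨fun n => ?_, hf 0⟩, fun g' hg' => ?_⟩
  · refine hT.1 _ (u n).2 _ ?_
    change pre f n <+: _
    rw [← mem_cyl_iff.1 (hf n), ← take_pre f (hlen n)]
    exact List.take_prefix _ _
  · obtain ⟨k, rfl⟩ := hg hg'
    obtain ⟨i, hi, hlt⟩ := h3 k (u k)
    exact ⟨i, hlt.trans_eq (hf (k + 1) i hi)⟩

/-! ### Positivity of finite approximations -/

/-- The section of `D` at the first coordinate `y`. -/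
def fiber {n : ℕ} (D : Set (Fin (n + 1) → ℕ → ℕ)) (y : ℕ → ℕ) : Set (Fin n → ℕ → ℕ) :=
  {x | (Fin.cons y x : Fin (n + 1) → ℕ → ℕ) ∈ D}

lemma mem_fiber {n : ℕ} {D : Set (Fin (n + 1) → ℕ → ℕ)} {y : ℕ → ℕ} {x : Fin n → ℕ → ℕ} :
    x ∈ fiber D y ↔ (Fin.cons y x : Fin (n + 1) → ℕ → ℕ) ∈ D := Iff.rfl

/-- Positivity of a set of possible values of a coordinate followed by `n` further coordinates:
being nonempty for the last coordinate, and being unbounded for the others. -/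
def PosAt : ℕ → Set (ℕ → ℕ) → Prop
  | 0, A => A.Nonempty
  | _ + 1, A => Pos A

lemma PosAt.mono {n : ℕ} {A B : Set (ℕ → ℕ)} (hA : PosAt n A) (h : A ⊆ B) : PosAt n B := by
  cases n with
  | zero => exact Set.Nonempty.mono h hA
  | succ n => exact Pos.mono hA h

lemma PosAt.nonempty {n : ℕ} {A : Set (ℕ → ℕ)} (hA : PosAt n A) : A.Nonempty := by
  cases n with
  | zero => exact hA
  | succ n => exact Pos.nonempty hA

lemma PosAt.exists_of_subset_iUnion {n : ℕ} {ι : Type*} [Countable ι] {A : Set (ℕ → ℕ)}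
    (hA : PosAt n A) {B : ι → Set (ℕ → ℕ)} (h : A ⊆ ⋃ i, B i) : ∃ i, PosAt n (B i) := by
  cases n with
  | zero =>
    obtain ⟨f, hf⟩ := hA
    obtain ⟨i, hi⟩ := Set.mem_iUnion.1 (h hf)
    exact ⟨i, f, hi⟩
  | succ n => exact Pos.exists_of_subset_iUnion hA h

/-- Given an assignment `S` of `(n + 1)`-tuples of nodes to the codes of finite sequences, the
assignment of `n`-tuples obtained by moving along the initial segments of `τ`. -/
def sec {n : ℕ} (S : ℕ → Fin (n + 1) → List ℕ) (τ : List ℕ) (i : ℕ) : Fin n → List ℕ :=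
  fun j => S (code (τ.take i)) j.succ

lemma sec_length {n : ℕ} (S : ℕ → Fin (n + 1) → List ℕ) (τ : List ℕ) :
    sec S τ τ.length = fun j => S (code τ) j.succ := by
  funext j
  simp [sec]

/-- `Lam n S k D` says that `D` is large enough to leave room for all future extensions of the
finite approximation given by the first `k` values of `S`. -/
def Lam : (n : ℕ) → (ℕ → Fin n → List ℕ) → ℕ → Set (Fin n → ℕ → ℕ) → Prop
  | 0, _, _, D => D.Nonempty
  | n + 1, S, k, D => ∀ j < k, {m | PosAt n {y ∈ cyl (S j 0 ++ [m]) |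
      Lam n (sec S (decode j)) ((decode j).length + 1) (fiber D y)}}.Infinite

lemma sec_eq_of_forall_lt {n : ℕ} {S S' : ℕ → Fin (n + 1) → List ℕ} {k : ℕ}
    (h : ∀ j < k, S j = S' j) {j : ℕ} (hj : j < k) (i : ℕ) :
    sec S (decode j) i = sec S' (decode j) i := by
  have := code_take_le (decode j) i
  rw [code_decode] at this
  funext l
  simp only [sec, h _ (this.trans_lt hj)]

lemma Lam.congr {n : ℕ} : ∀ {S S' : ℕ → Fin n → List ℕ} {k : ℕ} {D : Set (Fin n → ℕ → ℕ)},
    (∀ j < k, S j = S' j) → Lam n S k D → Lam n S' k D := by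
  induction n with
  | zero => exact fun _ h => h
  | succ n ih =>
    intro S S' k D hS h j hj
    refine (h j hj).mono fun m hm => PosAt.mono hm ?_
    rintro y ⟨hy, hL⟩
    rw [hS j hj] at hy
    exact ⟨hy, ih (fun i _ => sec_eq_of_forall_lt hS hj i) hL⟩

lemma Lam.mono {n : ℕ} : ∀ {S : ℕ → Fin n → List ℕ} {k : ℕ} {D D' : Set (Fin n → ℕ → ℕ)},
    Lam n S k D → D ⊆ D' → Lam n S k D' := by
  induction n with
  | zero => exact fun h hD => Set.Nonempty.mono hD h
  | succ n ih =>
    intro S k D D' h hD j hj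
    refine (h j hj).mono fun m hm => PosAt.mono hm ?_
    rintro y ⟨hy, hL⟩
    exact ⟨hy, ih hL fun x hx => hD hx⟩

/-- A product of cylinders. -/
def box {n : ℕ} (o : Fin n → List ℕ) : Set (Fin n → ℕ → ℕ) := {x | ∀ i, x i ∈ cyl (o i)}

lemma mem_box_succ {n : ℕ} {o : Fin (n + 1) → List ℕ} {x : Fin (n + 1) → ℕ → ℕ} :
    x ∈ box o ↔ x 0 ∈ cyl (o 0) ∧ (fun i => x i.succ) ∈ box fun i => o i.succ := by
  simp [box, Fin.forall_fin_succ]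

lemma isClopen_box {n : ℕ} (o : Fin n → List ℕ) : IsClopen (box o) := by
  have : box o = ⋂ i, (fun x : Fin n → ℕ → ℕ => x i) ⁻¹' cyl (o i) := by
    ext x
    simp [box]
  rw [this]
  exact ⟨isClosed_iInter fun i => (isClosed_cyl _).preimage (continuous_apply i),
    isOpen_iInter_of_finite fun i => (isOpen_cyl _).preimage (continuous_apply i)⟩

lemma Lam.inter_box_nonempty {n : ℕ} : ∀ {S : ℕ → Fin n → List ℕ} {k : ℕ}
    {D : Set (Fin n → ℕ → ℕ)}, Lam n S k D → ∀ j < k, (D ∩ box (S j)).Nonempty := by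
  induction n with
  | zero =>
    rintro S k D ⟨x, hx⟩ j -
    exact ⟨x, hx, fun i => i.elim0⟩
  | succ n ih =>
    intro S k D h j hj
    obtain ⟨m, hm⟩ := (h j hj).nonempty
    obtain ⟨y, hy, hL⟩ := PosAt.nonempty hm
    obtain ⟨x, hx, hxb⟩ := ih hL _ (Nat.lt_succ_self _)
    refine ⟨Fin.cons y x, hx, mem_box_succ.2 ⟨?_, ?_⟩⟩
    · simpa using cyl_anti (List.prefix_append _ _) hy
    · simpa [sec_length] using hxb

lemma Lam.exists_card_le {n : ℕ} : ∀ (S : ℕ → Fin n → List ℕ) (k : ℕ), ∃ N : ℕ,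
    ∀ D, Lam n S k D → ∀ (t : Finset ℝ) (U : ℝ → Set (Fin n → ℕ → ℕ)),
      (t : Set ℝ).PairwiseDisjoint U → (∀ p ∈ t, ¬ Lam n S k (D \ U p)) → t.card ≤ N := by
  induction n with
  | zero =>
    rintro - -
    refine ⟨1, fun D hD t U hU ht => Finset.card_le_one.2 fun p hp q hq => ?_⟩
    obtain ⟨x, hx⟩ := hD
    have hmem : ∀ p ∈ t, x ∈ U p := fun p hp => by
      by_contra h
      exact ht p hp ⟨x, hx, h⟩
    by_contra hne
    exact Set.disjoint_left.1 (hU hp hq hne) (hmem p hp) (hmem q hq)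
  | succ n ih =>
    intro S k
    choose N hN using fun j : ℕ => ih (sec S (decode j)) ((decode j).length + 1)
    refine ⟨∑ j ∈ Finset.range k, N j, fun D hD t U hU ht => ?_⟩
    classical
    let bad : ℕ → ℝ → Prop := fun j p => {m | PosAt n {y ∈ cyl (S j 0 ++ [m]) |
      Lam n (sec S (decode j)) ((decode j).length + 1) (fiber (D \ U p) y)}}.Finite
    have hsub : t ⊆ (Finset.range k).biUnion fun j => t.filter (bad j) := by
      intro p hp
      have := ht p hp
      simp only [Lam, not_forall, Set.not_infinite] at this
      obtain ⟨j, hj, hfin⟩ := this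
      rw [Finset.mem_biUnion]
      exact ⟨j, Finset.mem_range.2 hj, Finset.mem_filter.2 ⟨hp, hfin⟩⟩
    refine (Finset.card_le_card hsub).trans (Finset.card_biUnion_le.trans
      (Finset.sum_le_sum fun j hj => ?_))
    by_contra! hlt
    have hfin : (⋃ p ∈ t.filter (bad j), {m | PosAt n {y ∈ cyl (S j 0 ++ [m]) |
        Lam n (sec S (decode j)) ((decode j).length + 1) (fiber (D \ U p) y)}}).Finite :=
      Set.Finite.biUnion (Finset.finite_toSet _) fun p hp => (Finset.mem_filter.1 hp).2
    obtain ⟨m, hm, hmb⟩ := ((hD j (Finset.mem_range.1 hj)).sdiff hfin).nonempty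
    apply hmb
    obtain ⟨⟨p, hp⟩, hpos⟩ := PosAt.exists_of_subset_iUnion (ι := {p // p ∈ t.filter (bad j)})
      (B := fun p => {y ∈ cyl (S j 0 ++ [m]) |
        Lam n (sec S (decode j)) ((decode j).length + 1) (fiber (D \ U p) y)}) hm (by
      rintro y ⟨hy, hL⟩
      by_contra hno
      refine absurd (hN j _ hL (t.filter (bad j)) (fun p => fiber (U p) y) ?_ ?_) (not_le.2 hlt)
      · intro p hp q hq hne
        refine Set.disjoint_left.2 fun x hx hx' => ?_
        exact Set.disjoint_left.1 (hU (Finset.mem_filter.1 hp).1 (Finset.mem_filter.1 hq).1 hne)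
          hx hx'
      · intro p hp hLp
        exact hno (Set.mem_iUnion.2 ⟨⟨p, hp⟩, hy, hLp⟩))
    exact Set.mem_biUnion hp hpos

/-! ### Families of small balls -/

/-- A family of balls with rational data is fine if it contains all small balls around all but
finitely many reals. -/
def Fine (W : Set (ℚ × ℚ)) : Prop :=
  ∃ B : Set ℝ, B.Finite ∧ ∀ p ∉ B, ∃ ε > 0, ∀ q r : ℚ, 0 < r → (r : ℝ) < ε →
    p ∈ Metric.ball (q : ℝ) r → (q, r) ∈ W

lemma fine_univ : Fine Set.univ := ⟨∅, Set.finite_empty, fun _ _ => ⟨1, one_pos, by simp⟩⟩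

lemma Fine.inter {W W' : Set (ℚ × ℚ)} (h : Fine W) (h' : Fine W') : Fine (W ∩ W') := by
  obtain ⟨B, hB, hW⟩ := h
  obtain ⟨B', hB', hW'⟩ := h'
  refine ⟨B ∪ B', hB.union hB', fun p hp => ?_⟩
  rw [Set.mem_union, not_or] at hp
  obtain ⟨ε, hε, h⟩ := hW p hp.1
  obtain ⟨ε', hε', h'⟩ := hW' p hp.2
  exact ⟨min ε ε', lt_min hε hε', fun q r hr hlt hpr =>
    ⟨h q r hr (hlt.trans_le (min_le_left _ _)) hpr, h' q r hr (hlt.trans_le (min_le_right _ _)) hpr⟩⟩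

lemma exists_rat_mem_half_ball (p : ℝ) {ε : ℝ} (hε : 0 < ε) :
    ∃ q r : ℚ, 0 < r ∧ (r : ℝ) < ε ∧ p ∈ Metric.ball (q : ℝ) (r / 2) := by
  obtain ⟨r, hr, hrε⟩ := exists_rat_btwn hε
  obtain ⟨q, hq, hq'⟩ := exists_rat_btwn (show p - r / 2 < p by linarith)
  refine ⟨q, r, by exact_mod_cast hr, hrε, ?_⟩
  rw [Metric.mem_ball, Real.dist_eq, abs_lt]
  constructor <;> linarith

lemma Fine.exists_mem {W : Set (ℚ × ℚ)} (hW : Fine W) {A : Set ℝ} (hA : A.Infinite) :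
    ∃ p ∈ A, ∃ b ∈ W, 0 < b.2 ∧ p ∈ Metric.ball (b.1 : ℝ) (b.2 / 2) := by
  obtain ⟨B, hB, h⟩ := hW
  obtain ⟨p, hpA, hpB⟩ := (hA.sdiff hB).nonempty
  obtain ⟨ε, hε, hp⟩ := h p hpB
  obtain ⟨q, r, hr, hrε, hpr⟩ := exists_rat_mem_half_ball p hε
  have hr' : (0 : ℝ) < r := by exact_mod_cast hr
  exact ⟨p, hpA, (q, r), hp q r hr hrε (Metric.ball_subset_ball (by linarith) hpr), hr, hpr⟩

lemma Lam.fine {n : ℕ} {S : ℕ → Fin n → List ℕ} {k : ℕ} {D : Set (Fin n → ℕ → ℕ)}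
    (h : Lam n S k D) (F : (Fin n → ℕ → ℕ) → ℝ) :
    Fine {b | Lam n S k (D \ F ⁻¹' Metric.closedBall (b.1 : ℝ) b.2)} := by
  obtain ⟨N, hN⟩ := Lam.exists_card_le S k
  refine ⟨{p | ∀ ε > 0, ∃ q r : ℚ, 0 < r ∧ (r : ℝ) < ε ∧ p ∈ Metric.ball (q : ℝ) r ∧
    ¬ Lam n S k (D \ F ⁻¹' Metric.closedBall (q : ℝ) r)}, ?_, fun p hp => ?_⟩
  · by_contra hinf
    obtain ⟨t, ht, hcard⟩ := Set.Infinite.exists_subset_card_eq hinf (N + 1)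
    obtain ⟨U, hU, hdisj⟩ := t.finite_toSet.t2_separation
    have hball : ∀ p : ℝ, ∃ q r : ℚ, p ∈ t → Metric.closedBall (q : ℝ) r ⊆ U p ∧
        ¬ Lam n S k (D \ F ⁻¹' Metric.closedBall (q : ℝ) r) := by
      intro p
      by_cases hp : p ∈ t
      · obtain ⟨ε, hε, hsub⟩ := Metric.isOpen_iff.1 (hU p).2 p (hU p).1
        obtain ⟨q, r, -, hrε, hpr, hL⟩ := ht hp (ε / 2) (half_pos hε)
        refine ⟨q, r, fun _ => ⟨fun z hz => hsub ?_, hL⟩⟩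
        rw [Metric.mem_closedBall] at hz
        rw [Metric.mem_ball] at hpr ⊢
        have := dist_triangle_right z p q
        linarith
      · exact ⟨0, 0, fun h => absurd h hp⟩
    choose q r hqr using hball
    have := hN D h t (fun p => F ⁻¹' Metric.closedBall (q p : ℝ) (r p)) ?_
      fun p hp => (hqr p hp).2
    · omega
    · intro p hp p' hp' hne
      exact ((hdisj hp hp' hne).mono (hqr p hp).1 (hqr p' hp').1).preimage F
  · simp only [Set.mem_ofPred_eq, not_forall, not_exists, not_and, not_not] at hp
    obtain ⟨ε, hε, h⟩ := hp
    exact ⟨ε, hε, h⟩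

/-! ### The extension step -/

/-- Every neighbourhood of every point of `D` allows, with all coordinates but the last one fixed,
infinitely many values of `F` and an infinite splitting of the last coordinate. -/
def Rich {n : ℕ} (D : Set (Fin (n + 1) → ℕ → ℕ)) (F : (Fin (n + 1) → ℕ → ℕ) → ℝ) : Prop :=
  ∀ x ∈ D, ∀ O : Set (Fin (n + 1) → ℕ → ℕ), IsOpen O → x ∈ O →
    (F '' {z ∈ D ∩ O | ∀ i, i ≠ Fin.last n → z i = x i}).Infinite ∧
    ∃ s, {m | ∃ z ∈ D ∩ O, (∀ i, i ≠ Fin.last n → z i = x i) ∧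
      z (Fin.last n) ∈ cyl (s ++ [m])}.Infinite

lemma Rich.inter_isOpen {n : ℕ} {D O : Set (Fin (n + 1) → ℕ → ℕ)}
    {F : (Fin (n + 1) → ℕ → ℕ) → ℝ} (h : Rich D F) (hO : IsOpen O) : Rich (D ∩ O) F := by
  rintro x ⟨hxD, hxO⟩ O' hO' hxO'
  rw [Set.inter_assoc]
  exact h x hxD (O ∩ O') (hO.inter hO') ⟨hxO, hxO'⟩

lemma continuous_cons {n : ℕ} (y : ℕ → ℕ) :
    Continuous fun x : Fin n → ℕ → ℕ => (Fin.cons y x : Fin (n + 1) → ℕ → ℕ) :=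
  continuous_const.finCons continuous_id

lemma continuous_tail {n : ℕ} :
    Continuous fun (x : Fin (n + 1) → ℕ → ℕ) (i : Fin n) => x i.succ :=
  continuous_pi fun i => continuous_apply i.succ

lemma cons_tail {n : ℕ} (x : Fin (n + 1) → ℕ → ℕ) :
    (Fin.cons (x 0) (fun i => x i.succ) : Fin (n + 1) → ℕ → ℕ) = x :=
  Fin.cons_self_tail x

lemma Rich.fiber {n : ℕ} {D : Set (Fin (n + 2) → ℕ → ℕ)} {F : (Fin (n + 2) → ℕ → ℕ) → ℝ}
    (h : Rich D F) (y : ℕ → ℕ) :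
    Rich (fiber D y) fun x => F (Fin.cons y x : Fin (n + 2) → ℕ → ℕ) := by
  intro x hx O hO hxO
  obtain ⟨h1, s, h2⟩ := h _ hx _ (hO.preimage continuous_tail) (by simpa using hxO)
  have key : ∀ z : Fin (n + 2) → ℕ → ℕ, z ∈ D ∩ (fun x i => x (Fin.succ i)) ⁻¹' O →
      (∀ i, i ≠ Fin.last (n + 1) → z i = (Fin.cons y x : Fin (n + 2) → ℕ → ℕ) i) →
      (Fin.cons y fun i => z i.succ : Fin (n + 2) → ℕ → ℕ) = z ∧
      (fun i => z i.succ) ∈ LargeSet.fiber D y ∩ O ∧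
      ∀ i, i ≠ Fin.last n → z i.succ = x i := by
    rintro z ⟨hzD, hzO⟩ hz
    have h0 : z 0 = y := hz 0 (Fin.last_pos.ne)
    have hc : (Fin.cons y fun i => z i.succ : Fin (n + 2) → ℕ → ℕ) = z := by
      rw [← h0]
      exact cons_tail z
    refine ⟨hc, ⟨?_, hzO⟩, fun i hi => ?_⟩
    · rw [mem_fiber, hc]
      exact hzD
    · simpa using hz i.succ (by rwa [← Fin.succ_last, Ne, Fin.succ_inj])
  refine ⟨h1.mono ?_, s, h2.mono ?_⟩
  · rintro _ ⟨z, ⟨hz, hzx⟩, rfl⟩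
    obtain ⟨hc, hm, ha⟩ := key z hz hzx
    exact ⟨_, ⟨hm, ha⟩, congrArg F hc⟩
  · rintro m ⟨z, hz, hzx, hzm⟩
    obtain ⟨hc, hm, ha⟩ := key z hz hzx
    exact ⟨_, hm, ha, by simpa using hzm⟩

/-- The part of `D` where membership in `box o` is decided by whether `F` takes values near the
centre of the ball `b`. -/
def shrink {n : ℕ} (D : Set (Fin n → ℕ → ℕ)) (F : (Fin n → ℕ → ℕ) → ℝ) (o : Fin n → List ℕ)
    (b : ℚ × ℚ) : Set (Fin n → ℕ → ℕ) :=
  {x ∈ D | (x ∈ box o ∧ F x ∈ Metric.ball (b.1 : ℝ) (b.2 / 2)) ∨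
    (x ∉ box o ∧ F x ∉ Metric.closedBall (b.1 : ℝ) b.2)}

lemma exists_shrink_eq_inter {n : ℕ} {D : Set (Fin n → ℕ → ℕ)} {F : (Fin n → ℕ → ℕ) → ℝ}
    (hF : ContinuousOn F D) (o : Fin n → List ℕ) (b : ℚ × ℚ) :
    ∃ O, IsOpen O ∧ shrink D F o b = D ∩ O := by
  obtain ⟨O₁, hO₁, h₁⟩ := continuousOn_iff'.1 hF _ (Metric.isOpen_ball (x := (b.1 : ℝ))
    (ε := (b.2 : ℝ) / 2))
  obtain ⟨O₂, hO₂, h₂⟩ := continuousOn_iff'.1 hF _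
    (Metric.isClosed_closedBall (x := (b.1 : ℝ)) (ε := (b.2 : ℝ))).isOpen_compl
  refine ⟨box o ∩ O₁ ∪ (box o)ᶜ ∩ O₂, ((isClopen_box o).isOpen.inter hO₁).union
    ((isClopen_box o).compl.isOpen.inter hO₂), ?_⟩
  ext x
  have e₁ := Set.ext_iff.1 h₁ x
  have e₂ := Set.ext_iff.1 h₂ x
  simp only [Set.mem_inter_iff, Set.mem_preimage, Set.mem_compl_iff] at e₁ e₂
  simp only [shrink, Set.mem_ofPred_eq, Set.mem_inter_iff, Set.mem_union, Set.mem_compl_iff]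
  tauto

lemma fiber_shrink {n : ℕ} {D : Set (Fin (n + 1) → ℕ → ℕ)} {F : (Fin (n + 1) → ℕ → ℕ) → ℝ}
    {o : Fin (n + 1) → List ℕ} {b : ℚ × ℚ} {y : ℕ → ℕ} (hy : y ∈ cyl (o 0)) :
    fiber (shrink D F o b) y =
      shrink (fiber D y) (fun x => F (Fin.cons y x : Fin (n + 1) → ℕ → ℕ)) (fun i => o i.succ) b := by
  ext x
  simp only [fiber, shrink, mem_box_succ, Set.mem_ofPred_eq, Fin.cons_zero, Fin.cons_succ, hy,
    true_and]

lemma fiber_diff_subset_fiber_shrink {n : ℕ} {D : Set (Fin (n + 1) → ℕ → ℕ)}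
    {F : (Fin (n + 1) → ℕ → ℕ) → ℝ} {o : Fin (n + 1) → List ℕ} {b : ℚ × ℚ} {y : ℕ → ℕ}
    (hy : y ∉ cyl (o 0)) :
    fiber (D \ F ⁻¹' Metric.closedBall (b.1 : ℝ) b.2) y ⊆ fiber (shrink D F o b) y := by
  rintro x ⟨hx, hxF⟩
  refine ⟨hx, Or.inr ⟨fun h => hy ?_, hxF⟩⟩
  simpa using (mem_box_succ.1 h).1

lemma exists_disjoint_cyl {s u : List ℕ} (h : ¬ u <+: s) :
    ∃ m₀, ∀ m, m ≠ m₀ → Disjoint (cyl (s ++ [m])) (cyl u) := by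
  refine ⟨(u[s.length]?).getD 0, fun m hm => Set.disjoint_left.2 fun y hy hyu => hm ?_⟩
  rw [mem_cyl_append] at hy
  have hlt : s.length < u.length := by
    by_contra! hle
    exact h (prefix_of_mem_cyl hyu hy.1 hle)
  rw [List.getElem?_eq_getElem hlt, Option.getD_some, hyu _ hlt, hy.2]

lemma sec_update {n : ℕ} (S : ℕ → Fin (n + 1) → List ℕ) (k : ℕ) (o : Fin (n + 1) → List ℕ)
    {i : ℕ} (hi : i ≤ (decode k).length) :
    sec (Function.update S k o) (decode k) i =
      Function.update (sec S (decode k)) (decode k).length (fun j => o j.succ) i := by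
  funext j
  rcases hi.eq_or_lt with rfl | hlt
  · simp [sec]
  · have := code_take_lt hlt
    rw [code_decode] at this
    simp [sec, Function.update_of_ne this.ne, Function.update_of_ne hlt.ne]

lemma lam_update_shrink {n : ℕ} {S : ℕ → Fin (n + 1) → List ℕ} {k : ℕ}
    {D : Set (Fin (n + 1) → ℕ → ℕ)} {F : (Fin (n + 1) → ℕ → ℕ) → ℝ}
    {o : Fin (n + 1) → List ℕ} {b : ℚ × ℚ}
    (hL : Lam (n + 1) S k (D \ F ⁻¹' Metric.closedBall (b.1 : ℝ) b.2))
    (ho : ∀ j < k, ¬ o 0 <+: S j 0)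
    (hnew : {m | PosAt n {y ∈ cyl (o 0 ++ [m]) |
      Lam n (Function.update (sec S (decode k)) (decode k).length fun i => o i.succ)
        ((decode k).length + 1) (shrink (fiber D y)
          (fun x => F (Fin.cons y x : Fin (n + 1) → ℕ → ℕ)) (fun i => o i.succ) b)}}.Infinite) :
    Lam (n + 1) (Function.update S k o) (k + 1) (shrink D F o b) := by
  intro j hj
  rcases (Nat.lt_succ_iff.1 hj).eq_or_lt with rfl | hlt
  · refine hnew.mono fun m hm => PosAt.mono hm ?_
    rintro y ⟨hy, hyL⟩
    rw [Function.update_self]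
    refine ⟨hy, ?_⟩
    rw [fiber_shrink (cyl_anti (List.prefix_append _ _) hy)]
    exact hyL.congr fun i hi => (sec_update S j o (Nat.lt_succ_iff.1 hi)).symm
  · obtain ⟨m₀, hm₀⟩ := exists_disjoint_cyl (ho j hlt)
    refine ((hL j hlt).sdiff (Set.finite_singleton m₀)).mono ?_
    rintro m ⟨hm, hne⟩
    refine PosAt.mono hm ?_
    rintro y ⟨hy, hyL⟩
    rw [Function.update_of_ne hlt.ne]
    refine ⟨hy, (hyL.congr fun i _ => ?_).mono
      (fiber_diff_subset_fiber_shrink (Set.disjoint_left.1 (hm₀ m hne) hy))⟩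
    exact sec_eq_of_forall_lt (k := k) (fun l hl => (Function.update_of_ne hl.ne _ _).symm) hlt i

/-- `Ext n S k o` says that `o` may be added at place `k` to a finite approximation consisting of
the first `k` values of `S`. -/
def Ext : (n : ℕ) → (ℕ → Fin n → List ℕ) → ℕ → (Fin n → List ℕ) → Prop
  | 0, _, _, _ => True
  | n + 1, S, k, o => (∃ m, k ≤ m ∧ (∀ j < k, m ∉ S j 0) ∧
      S (code (decode k).dropLast) 0 ++ [m] <+: o 0) ∧
      Ext n (sec S (decode k)) (decode k).length fun i => o i.succ

lemma sec_decode_eq {n : ℕ} {S S' : ℕ → Fin (n + 1) → List ℕ} {k : ℕ}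
    (h : ∀ j < k, S j = S' j) {i : ℕ} (hi : i < (decode k).length) :
    sec S (decode k) i = sec S' (decode k) i := by
  have := code_take_lt hi
  rw [code_decode] at this
  funext l
  simp only [sec, h _ this]

lemma Ext.congr {n : ℕ} : ∀ {S S' : ℕ → Fin n → List ℕ} {k : ℕ} {o : Fin n → List ℕ},
    1 ≤ k → (∀ j < k, S j = S' j) → Ext n S k o → Ext n S' k o := by
  induction n with
  | zero => exact fun _ _ h => h
  | succ n ih =>
    rintro S S' k o hk hS ⟨⟨m, hkm, hm, hp⟩, hE⟩
    refine ⟨⟨m, hkm, fun j hj => hS j hj ▸ hm j hj, ?_⟩,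
      ih (length_decode_pos hk) (fun i hi => sec_decode_eq hS hi) hE⟩
    rwa [← hS _ (code_dropLast_lt hk)]

lemma exists_parent {n : ℕ} {S : ℕ → Fin (n + 1) → List ℕ} {k : ℕ}
    {D : Set (Fin (n + 1) → ℕ → ℕ)} (hk : 1 ≤ k) (h : Lam (n + 1) S k D) :
    ∃ m, k ≤ m ∧ (∀ j < k, m ∉ S j 0) ∧
      PosAt n {y ∈ cyl (S (code (decode k).dropLast) 0 ++ [m]) |
        Lam n (sec S (decode k)) (decode k).length (fiber D y)} := by
  have hpos := length_decode_pos hk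
  have hfin : (⋃ j ∈ Finset.range k, {m | m ∈ S j 0}).Finite :=
    Set.Finite.biUnion (Finset.finite_toSet _) fun j _ => List.finite_toSet _
  obtain ⟨m, hm, hmb⟩ := ((h _ (code_dropLast_lt hk)).sdiff
    (hfin.union (Set.finite_lt_nat k))).nonempty
  rw [Set.mem_union, not_or] at hmb
  refine ⟨m, by simpa using hmb.2, fun j hj hmj => hmb.1 ?_, PosAt.mono hm ?_⟩
  · exact Set.mem_biUnion (Finset.mem_coe.2 (Finset.mem_range.2 hj)) hmj
  · rintro y ⟨hy, hL⟩
    refine ⟨hy, ?_⟩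
    have hlen : (decode k).dropLast.length + 1 = (decode k).length := by
      rw [List.length_dropLast]
      omega
    rw [decode_code, hlen] at hL
    refine hL.congr fun i hi => ?_
    funext l
    simp only [sec, List.dropLast_eq_take, List.take_take,
      min_eq_left (show i ≤ (decode k).length - 1 by omega)]

lemma not_prefix_of_append_prefix {s t u : List ℕ} {m : ℕ} (h : s ++ [m] <+: u) (hm : m ∉ t) :
    ¬ u <+: t := fun hut => hm (hut.subset (h.subset (by simp)))

theorem exists_shrink {n : ℕ} : ∀ {S : ℕ → Fin (n + 1) → List ℕ} {k : ℕ}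
    {D : Set (Fin (n + 1) → ℕ → ℕ)} {F : (Fin (n + 1) → ℕ → ℕ) → ℝ} {W : Set (ℚ × ℚ)},
    1 ≤ k → Lam (n + 1) S k D → Rich D F → ContinuousOn F D → Fine W →
    ∃ (o : Fin (n + 1) → List ℕ) (b : ℚ × ℚ), b ∈ W ∧ 0 < b.2 ∧ Ext (n + 1) S k o ∧
      Lam (n + 1) (Function.update S k o) (k + 1) (shrink D F o b) := by
  induction n with
  | zero =>
    intro S k D F W hk hL hR hF hW
    obtain ⟨m, hkm, hm, y, hy, x, hx⟩ := exists_parent hk hL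
    set s' := S (code (decode k).dropLast) 0 with hs'
    set z : Fin 1 → ℕ → ℕ := Fin.cons y x with hz
    have hO : IsOpen {z : Fin 1 → ℕ → ℕ | z 0 ∈ cyl (s' ++ [m])} :=
      (isOpen_cyl _).preimage (continuous_apply 0)
    obtain ⟨_, ⟨w, ⟨hwO, -⟩, rfl⟩, b, hb, hb0, hwb⟩ :=
      (hW.inter (hL.fine F)).exists_mem (hR z hx _ hO hy).1
    obtain ⟨O, hOo, hOD⟩ := continuousOn_iff'.1 hF _ (Metric.isOpen_ball (x := (b.1 : ℝ))
      (ε := (b.2 : ℝ) / 2))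
    have hwO' : w ∈ O := by
      have : w ∈ F ⁻¹' Metric.ball (b.1 : ℝ) (b.2 / 2) ∩ D := ⟨hwb, hwO.1⟩
      rw [hOD] at this
      exact this.1
    obtain ⟨-, s, hs⟩ := hR w hwO.1 _ (hO.inter hOo) ⟨hwO.2, hwO'⟩
    have hpre : s' ++ [m] <+: s := by
      refine prefix_of_infinite_split subset_rfl (hs.mono ?_)
      rintro m' ⟨v, hv, -, hvm⟩
      exact ⟨v 0, hv.2.1, hvm⟩
    refine ⟨fun _ => s, b, hb.1, hb0, ⟨⟨m, hkm, hm, hpre⟩, trivial⟩, lam_update_shrink hb.2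
      (fun j hj => not_prefix_of_append_prefix hpre (hm j hj)) (hs.mono ?_)⟩
    rintro m' ⟨v, hv, -, hvm⟩
    have hvc : (Fin.cons (v 0) (fun i => v i.succ) : Fin 1 → ℕ → ℕ) = v := cons_tail v
    refine ⟨v 0, hvm, fun i => v i.succ, ?_, Or.inl ⟨fun i => i.elim0, ?_⟩⟩
    · rw [mem_fiber, hvc]
      exact hv.1
    · change F (Fin.cons (v 0) fun i => v i.succ : Fin 1 → ℕ → ℕ) ∈ _
      rw [hvc]
      have : v ∈ O ∩ D := ⟨hv.2.2, hv.1⟩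
      rw [← hOD] at this
      exact this.1
  | succ n ih =>
    intro S k D F W hk hL hR hF hW
    obtain ⟨m, hkm, hm, hpos⟩ := exists_parent hk hL
    set s' := S (code (decode k).dropLast) 0 with hs'
    set τ := decode k with hτ
    obtain ⟨⟨o', b⟩, hob⟩ := PosAt.exists_of_subset_iUnion
      (B := fun p : (Fin (n + 1) → List ℕ) × (ℚ × ℚ) => {y ∈ cyl (s' ++ [m]) |
        p.2 ∈ W ∩ {b | Lam (n + 2) S k (D \ F ⁻¹' Metric.closedBall (b.1 : ℝ) b.2)} ∧ 0 < p.2.2 ∧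
        Ext (n + 1) (sec S τ) τ.length p.1 ∧
        Lam (n + 1) (Function.update (sec S τ) τ.length p.1) (τ.length + 1)
          (shrink (fiber D y) (fun x => F (Fin.cons y x : Fin (n + 2) → ℕ → ℕ)) p.1 p.2)}) hpos (by
      rintro y ⟨hy, hyL⟩
      obtain ⟨o, b, h⟩ := ih (length_decode_pos hk) hyL (hR.fiber y)
        (hF.comp (continuous_cons y).continuousOn fun x hx => hx) (hW.inter (hL.fine F))
      exact Set.mem_iUnion.2 ⟨(o, b), hy, h⟩)
    obtain ⟨y, -, hb, hb0, hE, -⟩ := PosAt.nonempty hob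
    obtain ⟨s, hs⟩ := Pos.exists_infinite_split hob
    have hpre : s' ++ [m] <+: s :=
      prefix_of_infinite_split (fun y hy => hy.1) (hs.mono fun m' hm' => Pos.nonempty hm')
    refine ⟨Fin.cons s o', b, hb.1, hb0, ⟨⟨m, hkm, hm, by simpa using hpre⟩, by simpa using hE⟩,
      lam_update_shrink hb.2 (fun j hj => ?_) (hs.mono ?_)⟩
    · simpa using not_prefix_of_append_prefix hpre (hm j hj)
    · intro m' hm'
      refine Pos.mono hm' ?_
      rintro y ⟨⟨-, -, -, -, hyL⟩, hy⟩
      exact ⟨by simpa using hy, by simpa using hyL⟩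

/-! ### The initial approximation -/

/-- `D` is large with respect to iterated positivity of its sections. -/
def Init : (n : ℕ) → Set (Fin n → ℕ → ℕ) → Prop
  | 0, D => D.Nonempty
  | n + 1, D => PosAt n {y | Init n (fiber D y)}

lemma Init.exists_lam {n : ℕ} : ∀ {D : Set (Fin (n + 1) → ℕ → ℕ)}
    {F : (Fin (n + 1) → ℕ → ℕ) → ℝ}, Init (n + 1) D → Rich D F →
    ∃ o : Fin (n + 1) → List ℕ, Lam (n + 1) (fun _ => o) 1 D := by
  induction n with
  | zero =>
    rintro D F ⟨y, x, hx⟩ hR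
    obtain ⟨-, s, hs⟩ := hR _ hx Set.univ isOpen_univ trivial
    refine ⟨fun _ => s, fun j _ => hs.mono ?_⟩
    rintro m ⟨v, hv, -, hvm⟩
    refine ⟨v 0, hvm, fun i => v i.succ, ?_⟩
    rw [mem_fiber, cons_tail v]
    exact hv.1
  | succ n ih =>
    intro D F hD hR
    obtain ⟨o, ho⟩ := PosAt.exists_of_subset_iUnion
      (B := fun o : Fin (n + 1) → List ℕ => {y | Lam (n + 1) (fun _ => o) 1 (fiber D y)}) hD
      fun y hy => Set.mem_iUnion.2 (ih hy (hR.fiber y))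
    obtain ⟨s, hs⟩ := Pos.exists_infinite_split ho
    refine ⟨Fin.cons s o, fun j hj => ?_⟩
    obtain rfl : j = 0 := by omega
    refine hs.mono fun m hm => Pos.mono hm ?_
    rintro y ⟨hyL, hy⟩
    refine ⟨by simpa using hy, ?_⟩
    rw [decode_zero]
    exact Lam.congr (fun i _ => by funext l; simp [sec]) hyL

theorem exists_approximation {n : ℕ} {X : Set (Fin (n + 1) → ℕ → ℕ)}
    {F : (Fin (n + 1) → ℕ → ℕ) → ℝ} (hX : Init (n + 1) X) (hR : Rich X F) (hF : ContinuousOn F X) :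
    ∃ (S : ℕ → Fin (n + 1) → List ℕ) (b : ℕ → ℚ × ℚ) (D : ℕ → Set (Fin (n + 1) → ℕ → ℕ)),
      (∀ k, 1 ≤ k → Ext (n + 1) S k (S k)) ∧ (∀ k, 0 < (b k).2) ∧
      (∀ k, D k ⊆ X) ∧ (∀ k, 1 ≤ k → Lam (n + 1) S k (D k)) ∧
      (∀ k, 1 ≤ k → D (k + 1) = shrink (D k) F (S k) (b k)) := by
  obtain ⟨o₀, ho₀⟩ := hX.exists_lam hR
  let Inv : ℕ → (ℕ → Fin (n + 1) → List ℕ) × Set (Fin (n + 1) → ℕ → ℕ) → Prop := fun k p =>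
    Lam (n + 1) p.1 (k + 1) p.2 ∧ ∃ O, IsOpen O ∧ p.2 = X ∩ O
  have step : ∀ k (p : {p // Inv k p}), ∃ (p' : {p // Inv (k + 1) p})
      (o : Fin (n + 1) → List ℕ) (b : ℚ × ℚ), 0 < b.2 ∧ Ext (n + 1) p.1.1 (k + 1) o ∧
      p'.1.1 = Function.update p.1.1 (k + 1) o ∧ p'.1.2 = shrink p.1.2 F o b := by
    rintro k ⟨⟨S, D⟩, hL, O, hO, hD⟩
    obtain rfl : D = X ∩ O := hD
    have hFO : ContinuousOn F (X ∩ O) := hF.mono Set.inter_subset_left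
    obtain ⟨o, b, -, hb, hE, hL'⟩ := exists_shrink (Nat.le_add_left 1 k) hL (hR.inter_isOpen hO)
      hFO fine_univ
    obtain ⟨O', hO', hs⟩ := exists_shrink_eq_inter hFO o b
    exact ⟨⟨(_, _), hL', O ∩ O', hO.inter hO', hs.trans (Set.inter_assoc _ _ _)⟩, o, b, hb, hE,
      rfl, rfl⟩
  choose nxt o b hb hE h1 h2 using step
  let st : (k : ℕ) → {p // Inv k p} := fun k => Nat.rec (motive := fun k => {p // Inv k p})
    ⟨(fun _ => o₀, X), ho₀, Set.univ, isOpen_univ, (Set.inter_univ X).symm⟩ nxt k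
  let S : ℕ → Fin (n + 1) → List ℕ := fun k => (st k).1.1 k
  have hstab : ∀ k j, j ≤ k → (st k).1.1 j = S j := by
    intro k j hj
    induction k, hj using Nat.le_induction with
    | base => rfl
    | succ k hjk ih =>
      change (nxt k (st k)).1.1 j = _
      rw [h1, Function.update_of_ne (by omega), ih]
  have hS : ∀ k, S (k + 1) = o k (st k) := fun k => by
    change (nxt k (st k)).1.1 (k + 1) = _
    rw [h1, Function.update_self]
  refine ⟨S, fun k => b (k - 1) (st (k - 1)), fun k => (st (k - 1)).1.2, ?_, fun k => hb _ _, ?_,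
    ?_, ?_⟩
  · rintro (_ | k) hk
    · omega
    · rw [hS]
      exact (hE k (st k)).congr hk fun j hj => hstab k j (Nat.lt_succ_iff.1 hj)
  · intro k
    obtain ⟨O, -, hO⟩ := (st (k - 1)).2.2
    change (st (k - 1)).1.2 ⊆ X
    rw [hO]
    exact Set.inter_subset_left
  · rintro (_ | k) hk
    · omega
    · exact (st k).2.1.congr fun j hj => hstab k j (Nat.lt_succ_iff.1 hj)
  · rintro (_ | k) hk
    · omega
    · rw [hS]
      exact h2 k (st k)

/-! ### The limit set of an approximation -/

/-- Every value of `S` is a permitted extension of the preceding ones. -/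
def Legal (n : ℕ) (S : ℕ → Fin n → List ℕ) : Prop := ∀ k, 1 ≤ k → Ext n S k (S k)

/-- The approximation of the remaining coordinates when the first one follows `a`. -/
def along {n : ℕ} (S : ℕ → Fin (n + 1) → List ℕ) (a : ℕ → ℕ) (i : ℕ) : Fin n → List ℕ :=
  fun j => S (code (pre a i)) j.succ

/-- `y` is the branch of the first coordinate of `S` determined by `a`. -/
def Follows {n : ℕ} (S : ℕ → Fin (n + 1) → List ℕ) (a y : ℕ → ℕ) : Prop :=
  ∀ k, y ∈ cyl (S (code (pre a k)) 0)

/-- The set of points determined by the approximation `S`. -/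
def limitSet : (n : ℕ) → (ℕ → Fin n → List ℕ) → Set (Fin n → ℕ → ℕ)
  | 0, _ => Set.univ
  | n + 1, S => {x | ∃ a, Follows S a (x 0) ∧ (fun i => x i.succ) ∈ limitSet n (along S a)}

section Legal

variable {n : ℕ} {S : ℕ → Fin (n + 1) → List ℕ} {a a' y : ℕ → ℕ}

lemma Legal.along (h : Legal (n + 1) S) (a : ℕ → ℕ) : Legal n (along S a) := by
  intro k hk
  have hk' : 1 ≤ code (pre a k) := hk.trans (by simpa using length_le_code (pre a k))
  have := (h _ hk').2
  rw [decode_code, length_pre] at this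
  refine Ext.congr hk (fun j hj => ?_) this
  funext l
  simp only [sec, LargeSet.along, take_pre a hj.le]

lemma Legal.exists_child (h : Legal (n + 1) S) (τ : List ℕ) (i : ℕ) :
    ∃ m, code (τ ++ [i]) ≤ m ∧ (∀ j < code (τ ++ [i]), m ∉ S j 0) ∧
      S (code τ) 0 ++ [m] <+: S (code (τ ++ [i])) 0 := by
  have := (h _ (Nat.one_le_iff_ne_zero.2 (Nat.ne_zero_of_lt (code_lt_code_append τ i)))).1
  simpa using this

lemma Legal.mem_cyl_parent (h : Legal (n + 1) S) {τ : List ℕ} {i : ℕ}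
    (hy : y ∈ cyl (S (code (τ ++ [i])) 0)) : y ∈ cyl (S (code τ) 0) := by
  obtain ⟨m, -, -, hm⟩ := h.exists_child τ i
  exact (mem_cyl_append.1 (cyl_anti hm hy)).1

lemma Legal.entry_ne (h : Legal (n + 1) S) {τ : List ℕ} {i i' : ℕ} (hi : i ≠ i') {y y' : ℕ → ℕ}
    (hy : y ∈ cyl (S (code (τ ++ [i])) 0)) (hy' : y' ∈ cyl (S (code (τ ++ [i'])) 0)) :
    y (S (code τ) 0).length ≠ y' (S (code τ) 0).length := by
  wlog hlt : code (τ ++ [i]) < code (τ ++ [i']) generalizing i i' y y'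
  · refine (this hi.symm hy' hy (lt_of_le_of_ne (not_lt.1 hlt) fun h' => hi ?_)).symm
    simpa using (code_injective h').symm
  intro heq
  obtain ⟨m, -, -, hm⟩ := h.exists_child τ i
  obtain ⟨m', -, hm', hp⟩ := h.exists_child τ i'
  rw [(mem_cyl_append.1 (cyl_anti hm hy)).2, (mem_cyl_append.1 (cyl_anti hp hy')).2] at heq
  exact hm' _ hlt (hm.subset (by simp [heq]))

lemma Legal.eq_of_mem_cyl (h : Legal (n + 1) S) {σ τ : List ℕ} (hl : σ.length = τ.length)
    (hσ : y ∈ cyl (S (code σ) 0)) (hτ : y ∈ cyl (S (code τ) 0)) : σ = τ := by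
  induction σ using List.reverseRecOn generalizing τ with
  | nil => exact (List.length_eq_zero_iff.1 hl.symm).symm
  | append_singleton σ i ih =>
    rcases List.eq_nil_or_concat τ with rfl | ⟨τ, i', rfl⟩
    · simp at hl
    · rw [List.concat_eq_append] at *
      obtain rfl := ih (by simpa using hl) (h.mem_cyl_parent hσ) (h.mem_cyl_parent hτ)
      by_contra hne
      exact h.entry_ne (fun hi => hne (by rw [hi])) hσ hτ rfl

lemma Legal.follows_unique (h : Legal (n + 1) S) (ha : Follows S a y) (ha' : Follows S a' y) :
    a = a' := by
  funext k
  exact pre_inj.1 (h.eq_of_mem_cyl (by simp) (ha (k + 1)) (ha' (k + 1))) k (Nat.lt_succ_self k)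

lemma Legal.le_length (h : Legal (n + 1) S) (τ : List ℕ) : τ.length ≤ (S (code τ) 0).length := by
  induction τ using List.reverseRecOn with
  | nil => simp
  | append_singleton τ i ih =>
    obtain ⟨m, -, -, hm⟩ := h.exists_child τ i
    have := hm.length_le
    simp only [List.length_append, List.length_singleton] at this ⊢
    omega

lemma Legal.exists_follows (h : Legal (n + 1) S) (τ : List ℕ) :
    ∃ a y, Follows S a y ∧ y ∈ cyl (S (code τ) 0) := by
  let a : ℕ → ℕ := fun i => τ.getD i 0
  have ha : pre a τ.length = τ := by
    apply List.ext_getElem (by simp)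
    intro i h1 h2
    simp [a, h2]
  obtain ⟨y, hy⟩ := exists_forall_mem_cyl (u := fun k => S (code (pre a k)) 0) (fun k => by
    obtain ⟨m, -, -, hm⟩ := h.exists_child (pre a k) (a k)
    rw [← pre_succ] at hm
    exact (List.prefix_append _ _).trans hm) fun k => by simpa using h.le_length (pre a k)
  refine ⟨a, y, hy, ?_⟩
  have := hy τ.length
  rwa [ha] at this

lemma mem_cyl_of_agree {y y' : ℕ → ℕ} {L : ℕ} (h : y' ∈ cyl (pre y L)) {s : List ℕ}
    (hs : s.length ≤ L) : y' ∈ cyl s ↔ y ∈ cyl s := by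
  rw [mem_cyl_pre] at h
  exact forall₂_congr fun i hi => by rw [h i (hi.trans_le hs)]

lemma exists_follows_of_forall_exists (h0 : y ∈ cyl (S 0 0))
    (h : ∀ τ, y ∈ cyl (S (code τ) 0) → ∃ i, y ∈ cyl (S (code (τ ++ [i])) 0)) :
    ∃ a, Follows S a y := by
  choose! c hc using h
  let t : ℕ → List ℕ := fun k => Nat.rec [] (fun _ τ => τ ++ [c τ]) k
  have ht : ∀ k, pre (fun k => c (t k)) k = t k := by
    intro k
    induction k with
    | zero => rfl
    | succ k ih => rw [pre_succ, ih]
  refine ⟨fun k => c (t k), fun k => ?_⟩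
  rw [ht]
  induction k with
  | zero => simpa [t] using h0
  | succ k ih => exact hc _ ih

lemma exists_forall_not_follows (hy : ¬ ∃ a, Follows S a y) :
    ∃ K L, ∀ S', Legal (n + 1) S' → (∀ j < K, S j = S' j) →
      ∀ y' ∈ cyl (pre y L), ¬ ∃ a, Follows S' a y' := by
  by_cases h0 : y ∈ cyl (S 0 0)
  · obtain ⟨τ, hτ, hi⟩ : ∃ τ, y ∈ cyl (S (code τ) 0) ∧ ∀ i, y ∉ cyl (S (code (τ ++ [i])) 0) := by
      by_contra! hc
      exact hy (exists_follows_of_forall_exists h0 hc)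
    set l := (S (code τ) 0).length with hl
    set K := max (y l + 1) (code τ + 1) with hK
    set L := l + 1 + (Finset.range K).sup fun j => (S j 0).length with hL
    have hlen : ∀ j < K, (S j 0).length ≤ L := fun j hj =>
      (Finset.le_sup (f := fun j => (S j 0).length) (Finset.mem_range.2 hj)).trans (by omega)
    refine ⟨K, L, ?_⟩
    rintro S' hS' hSS' y' hy' ⟨a, ha⟩
    have hτ' : y' ∈ cyl (S' (code τ) 0) := by
      rw [← hSS' _ (by omega)]
      exact (mem_cyl_of_agree hy' (by omega)).2 hτ
    have hpre := hS'.eq_of_mem_cyl (by simp) (ha τ.length) hτ'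
    have hc := ha (τ.length + 1)
    rw [pre_succ, hpre] at hc
    obtain ⟨m, hm, -, hp⟩ := hS'.exists_child τ (a τ.length)
    have hm' := (mem_cyl_append.1 (cyl_anti hp hc)).2
    rw [← hSS' _ (by omega), ← hl, mem_cyl_pre.1 hy' l (by omega)] at hm'
    have hlt : code (τ ++ [a τ.length]) < K := by omega
    rw [← hSS' _ hlt] at hc
    exact hi _ ((mem_cyl_of_agree hy' (hlen _ hlt)).1 hc)
  · refine ⟨1, (S 0 0).length, ?_⟩
    rintro S' - hSS' y' hy' ⟨a, ha⟩
    have := ha 0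
    rw [pre_zero, code_nil, ← hSS' 0 one_pos] at this
    exact h0 ((mem_cyl_of_agree hy' le_rfl).1 this)

lemma fiber_limitSet (h : Legal (n + 1) S) (ha : Follows S a y) :
    fiber (limitSet (n + 1) S) y = limitSet n (along S a) := by
  ext x
  constructor
  · rintro ⟨a', ha', hx⟩
    obtain rfl := h.follows_unique ha ha'
    exact hx
  · exact fun hx => ⟨a, ha, hx⟩

end Legal

lemma exists_forall_notMem_limitSet {n : ℕ} : ∀ {S : ℕ → Fin n → List ℕ} {x : Fin n → ℕ → ℕ},
    x ∉ limitSet n S → ∃ K O, IsOpen O ∧ x ∈ O ∧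
      ∀ S', Legal n S' → (∀ j < K, S j = S' j) → ∀ x' ∈ O, x' ∉ limitSet n S' := by
  induction n with
  | zero => exact fun hx => absurd trivial hx
  | succ n ih =>
    intro S x hx
    by_cases hfol : ∃ a, Follows S a (x 0)
    · obtain ⟨a, ha⟩ := hfol
      obtain ⟨K, O, hO, hxO, hK⟩ := ih fun hx' => hx ⟨a, ha, hx'⟩
      refine ⟨code (pre a K) + 1, {x' | x' 0 ∈ cyl (S (code (pre a K)) 0)} ∩
        {x' | (fun i : Fin n => x' i.succ) ∈ O},
        ((isOpen_cyl _).preimage (continuous_apply 0)).inter (hO.preimage continuous_tail),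
        ⟨ha K, hxO⟩, ?_⟩
      rintro S' hS' hSS' x' ⟨hx'0, hx'O⟩ ⟨a', ha', hx'⟩
      refine hK _ (hS'.along a') (fun j hj => ?_) _ hx'O hx'
      rw [Set.mem_ofPred_eq, hSS' _ (Nat.lt_succ_self _)] at hx'0
      have hpre : pre a K = pre a' K := hS'.eq_of_mem_cyl (by simp) hx'0 (ha' K)
      have hj' : pre a j = pre a' j := by rw [← take_pre a hj.le, hpre, take_pre a' hj.le]
      have hlt : code (pre a j) ≤ code (pre a K) := by
        rw [← take_pre a hj.le]
        exact code_take_le _ _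
      funext i
      rw [along, along, ← hj', hSS' _ (Nat.lt_succ_of_le hlt)]
    · obtain ⟨K, L, hKL⟩ := exists_forall_not_follows hfol
      refine ⟨K, {x' | x' 0 ∈ cyl (pre (x 0) L)}, (isOpen_cyl _).preimage (continuous_apply 0),
        mem_cyl_pre.2 fun _ _ => rfl, ?_⟩
      rintro S' hS' hSS' x' hx' ⟨a, ha, -⟩
      exact hKL S' hS' hSS' _ hx' ⟨a, ha⟩

theorem isClosed_limitSet {n : ℕ} {S : ℕ → Fin n → List ℕ} (h : Legal n S) :
    IsClosed (limitSet n S) := by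
  refine isOpen_compl_iff.1 (isOpen_iff_forall_mem_open.2 fun x hx => ?_)
  obtain ⟨K, O, hO, hxO, hK⟩ := exists_forall_notMem_limitSet hx
  exact ⟨O, fun x' hx' => hK S h (fun _ _ => rfl) x' hx', hO, hxO⟩

lemma limitSet_nonempty {n : ℕ} : ∀ {S : ℕ → Fin n → List ℕ}, Legal n S →
    (limitSet n S).Nonempty := by
  induction n with
  | zero => exact fun _ => ⟨fun i => i.elim0, trivial⟩
  | succ n ih =>
    intro S h
    obtain ⟨a, y, hy, -⟩ := h.exists_follows []
    obtain ⟨x, hx⟩ := ih (h.along a)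
    exact ⟨Fin.cons y x, a, hy, hx⟩

lemma image_limitSet {n : ℕ} {S : ℕ → Fin (n + 1) → List ℕ} (h : Legal (n + 1) S) :
    (fun x => x 0) '' limitSet (n + 1) S = {y | ∃ a, Follows S a y} := by
  ext y
  constructor
  · rintro ⟨x, ⟨a, ha, -⟩, rfl⟩
    exact ⟨a, ha⟩
  · rintro ⟨a, ha⟩
    obtain ⟨x, hx⟩ := limitSet_nonempty (h.along a)
    exact ⟨Fin.cons y x, ⟨a, ha, hx⟩, rfl⟩

theorem isLargeBase_follows {n : ℕ} {S : ℕ → Fin (n + 1) → List ℕ} (h : Legal (n + 1) S) :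
    IsLargeBase {y | ∃ a, Follows S a y} := by
  set T : Set (List ℕ) := {t | ∃ y, (∃ a, Follows S a y) ∧ pre y t.length = t} with hT
  have hpre : ∀ {a y}, Follows S a y → ∀ k, pre y k ∈ T := fun {a y} ha k =>
    ⟨y, ⟨a, ha⟩, by rw [length_pre]⟩
  have hsplit : ∀ τ, S (code τ) 0 ∈ treeBeta T := by
    intro τ
    constructor
    · obtain ⟨a, y, ha, hy⟩ := h.exists_follows τ
      exact ⟨y, ⟨a, ha⟩, mem_cyl_iff.1 hy⟩
    · choose a y ha hy using fun i => h.exists_follows (τ ++ [i])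
      refine Set.infinite_of_injective_forall_mem
        (f := fun i => y i (S (code τ) 0).length) (fun i i' hii => ?_) fun i => ?_
      · by_contra hne
        exact h.entry_ne hne (hy i) (hy i') hii
      · refine ⟨y i, ⟨a i, ha i⟩, mem_cyl_iff.1 (mem_cyl_append.2 ⟨h.mem_cyl_parent (hy i), rfl⟩)⟩
  refine ⟨T, ⟨?_, ?_, ?_, ?_⟩, ?_⟩
  · rintro t ⟨y, hy, ht⟩ s hst
    exact ⟨y, hy, mem_cyl_iff.1 (cyl_anti hst (mem_cyl_iff.2 ht))⟩
  · exact ⟨_, (hsplit []).1⟩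
  · rintro t ⟨y, ⟨a, ha⟩, ht⟩
    refine ⟨_, hsplit (pre a t.length), prefix_of_mem_cyl (mem_cyl_iff.2 ht) (ha _) ?_⟩
    simpa using h.le_length (pre a t.length)
  · rintro t ⟨y, ⟨a, ha⟩, ht⟩
    by_cases hex : ∃ y', (∃ a', Follows S a' y') ∧ y' ∈ cyl t ∧ y' t.length ≠ y t.length
    · left
      obtain ⟨y', ⟨a', ha'⟩, ht', hne⟩ := hex
      have hty : y ∈ cyl t := mem_cyl_iff.2 ht
      have hlt : ∀ {s}, y ∈ cyl s → y' ∈ cyl s → s.length ≤ t.length := by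
        intro s hs hs'
        by_contra! hlt
        exact hne ((hs' _ hlt).symm.trans (hs _ hlt))
      have haa : ∃ k, a k ≠ a' k := by
        by_contra! hc
        obtain rfl : a = a' := funext hc
        have h1 := hlt (ha (t.length + 1)) (ha' (t.length + 1))
        have h2 := h.le_length (pre a (t.length + 1))
        rw [length_pre] at h2
        omega
      classical
      set k := Nat.find haa with hk
      have hpk : pre a' k = pre a k :=
        pre_inj.2 fun i hi => (not_not.1 (Nat.find_min haa hi)).symm
      have h1 := ha (k + 1)
      have h2 := ha' (k + 1)
      rw [pre_succ] at h1 h2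
      rw [hpk] at h2
      have hne' := h.entry_ne (Nat.find_spec haa) h1 h2
      have hle : (S (code (pre a k)) 0).length = t.length := by
        refine le_antisymm (hlt (ha k) (hpk ▸ ha' k)) ?_
        by_contra! hlt'
        exact hne' ((hty _ hlt').symm.trans (ht' _ hlt'))
      have hts : S (code (pre a k)) 0 = t := by
        rw [← ht, ← hle, mem_cyl_iff.1 (ha k)]
      exact hts ▸ (hsplit (pre a k)).2
    · right
      push Not at hex
      refine ⟨y t.length, ?_⟩
      ext m
      rw [Set.mem_ofPred_eq, Set.mem_singleton_iff]
      constructor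
      · rintro ⟨y', hy', hm⟩
        obtain ⟨h1, h2⟩ := mem_cyl_append.1 (mem_cyl_iff.2 hm)
        rw [← h2, hex y' hy' h1]
      · rintro rfl
        exact ⟨y, ⟨a, ha⟩, mem_cyl_iff.1 (mem_cyl_append.2 ⟨mem_cyl_iff.2 ht, rfl⟩)⟩
  · ext f
    constructor
    · rintro ⟨a, ha⟩ k
      exact hpre ha k
    · intro hf
      by_contra hc
      obtain ⟨K, L, hKL⟩ := exists_forall_not_follows hc
      obtain ⟨y, hy, hyL⟩ := hf L
      exact hKL S h (fun _ _ => rfl) y (mem_cyl_iff.2 hyL) hy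

lemma exists_mem_box {n : ℕ} : ∀ {S : ℕ → Fin n → List ℕ} {x : Fin n → ℕ → ℕ}, Legal n S →
    x ∈ limitSet n S → ∀ M, ∃ k, M ≤ k ∧ x ∈ box (S k) ∧ ∀ i, M ≤ (S k i).length := by
  induction n with
  | zero => exact fun _ _ M => ⟨M, le_rfl, fun i => i.elim0, fun i => i.elim0⟩
  | succ n ih =>
    rintro S x h ⟨a, ha, hx⟩ M
    obtain ⟨j, hj, hxj, hlen⟩ := ih (h.along a) hx M
    have h1 := length_le_code (pre a j)
    have h2 := h.le_length (pre a j)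
    rw [length_pre] at h1 h2
    exact ⟨code (pre a j), hj.trans h1, mem_box_succ.2 ⟨ha j, hxj⟩,
      Fin.cases (hj.trans h2) hlen⟩

/-! ### Large sets through their first coordinate -/

lemma fiber_image_init {n : ℕ} (X : Set (Fin (n + 2) → ℕ → ℕ)) (y : ℕ → ℕ) :
    fiber (Fin.init '' X : Set (Fin (n + 1) → ℕ → ℕ)) y = Fin.init '' fiber X y := by
  ext z
  constructor
  · rintro ⟨x, hx, hxz⟩
    refine ⟨fun i => x i.succ, ?_, ?_⟩
    · have h0 : y = x 0 := (congrFun hxz 0).symm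
      rw [mem_fiber, h0, cons_tail x]
      exact hx
    · funext i
      exact congrFun hxz i.succ
  · rintro ⟨x, hx, rfl⟩
    refine ⟨_, hx, ?_⟩
    funext i
    refine Fin.cases ?_ (fun i => ?_) i
    · rfl
    · rfl

lemma image_zero_image_init {n : ℕ} (X : Set (Fin (n + 2) → ℕ → ℕ)) :
    (fun x => x 0) '' (Fin.init '' X : Set (Fin (n + 1) → ℕ → ℕ)) = (fun x => x 0) '' X := by
  rw [Set.image_image]
  rfl

theorem isLarge_succ_succ_iff {n : ℕ} : ∀ {X : Set (Fin (n + 2) → ℕ → ℕ)},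
    IsLarge (n + 2) X ↔ IsLargeBase ((fun x => x 0) '' X) ∧
      ∀ y ∈ (fun x => x 0) '' X, IsLarge (n + 1) (fiber X y) := by
  induction n with
  | zero =>
    intro X
    have h : ∀ z : Fin 1 → ℕ → ℕ, (fun x => x 0) '' fiber X (z 0) =
        {g : ℕ → ℕ | (Fin.snoc z g : Fin 2 → ℕ → ℕ) ∈ X} := by
      intro z
      have hzg : ∀ x : Fin 1 → ℕ → ℕ,
          (Fin.cons (z 0) x : Fin 2 → ℕ → ℕ) = Fin.snoc z (x 0) := by
        intro x
        funext i
        fin_cases i <;> rfl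
      ext g
      constructor
      · rintro ⟨x, hx, rfl⟩
        rw [mem_fiber, hzg] at hx
        exact hx
      · intro hg
        refine ⟨fun _ => g, ?_, rfl⟩
        rw [mem_fiber, hzg]
        exact hg
    change IsLargeBase ((fun x => x 0) '' (Fin.init '' X)) ∧ _ ↔ _
    rw [image_zero_image_init]
    refine and_congr_right fun _ => ?_
    constructor
    · intro H y hy
      rw [← image_zero_image_init] at hy
      obtain ⟨z, hz, rfl⟩ := hy
      change IsLargeBase _
      rw [h]
      exact H z hz
    · intro H z hz
      rw [← h]
      exact H _ (image_zero_image_init X ▸ ⟨z, hz, rfl⟩)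
  | succ n ih =>
    intro X
    change IsLarge (n + 2) (Fin.init '' X) ∧ _ ↔ _
    rw [ih, image_zero_image_init, and_assoc]
    refine and_congr_right fun _ => ?_
    have hmem : ∀ (y : ℕ → ℕ) (z : Fin (n + 1) → ℕ → ℕ),
        (Fin.cons y z : Fin (n + 2) → ℕ → ℕ) ∈ Fin.init '' X ↔ z ∈ Fin.init '' fiber X y := by
      intro y z
      rw [← fiber_image_init]
      rfl
    constructor
    · rintro ⟨h1, h2⟩ y hy
      refine ⟨fiber_image_init X y ▸ h1 y hy, fun z hz => ?_⟩
      have := h2 _ ((hmem y z).2 hz)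
      simpa only [mem_fiber, Fin.cons_snoc_eq_snoc_cons] using this
    · intro h
      refine ⟨fun y hy => fiber_image_init X y ▸ (h y hy).1, fun w hw => ?_⟩
      have hc : (Fin.cons (w 0) (fun i => w i.succ) : Fin (n + 2) → ℕ → ℕ) = w := cons_tail w
      have hw0 : w 0 ∈ (fun x => x 0) '' X := by
        rw [← image_zero_image_init]
        exact ⟨w, hw, rfl⟩
      rw [← hc] at hw
      have := (h _ hw0).2 _ ((hmem _ _).1 hw)
      simp only [mem_fiber, Fin.cons_snoc_eq_snoc_cons] at this
      rwa [hc] at this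

theorem isLarge_limitSet {n : ℕ} : ∀ {S : ℕ → Fin (n + 1) → List ℕ}, Legal (n + 1) S →
    IsLarge (n + 1) (limitSet (n + 1) S) := by
  induction n with
  | zero =>
    intro S h
    change IsLargeBase _
    rw [image_limitSet h]
    exact isLargeBase_follows h
  | succ n ih =>
    intro S h
    rw [isLarge_succ_succ_iff, image_limitSet h]
    refine ⟨isLargeBase_follows h, ?_⟩
    rintro y ⟨a, ha⟩
    rw [fiber_limitSet h ha]
    exact ih (h.along a)

lemma pos_of_isLargeBase {A : Set (ℕ → ℕ)} (hA : IsLargeBase A) : Pos A := by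
  obtain ⟨T, hT, rfl⟩ := hA
  obtain ⟨t, ht⟩ := hT.2.1
  exact (pos_branchSet_inter_cyl hT ht).mono Set.inter_subset_left

lemma init_of_isLarge {n : ℕ} : ∀ {X : Set (Fin (n + 1) → ℕ → ℕ)}, IsLarge (n + 1) X →
    Init (n + 1) X := by
  induction n with
  | zero =>
    intro X hX
    obtain ⟨_, x, hx, rfl⟩ := (pos_of_isLargeBase hX).nonempty
    refine ⟨x 0, fun i => x i.succ, ?_⟩
    rw [mem_fiber, cons_tail x]
    exact hx
  | succ n ih =>
    intro X hX
    rw [isLarge_succ_succ_iff] at hX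
    exact (pos_of_isLargeBase hX.1).mono fun y hy => ih (hX.2 y hy)

lemma isLargeBase_update_last {n : ℕ} {X : Set (Fin (n + 1) → ℕ → ℕ)}
    (hX : IsLarge (n + 1) X) {x : Fin (n + 1) → ℕ → ℕ} (hx : x ∈ X) :
    IsLargeBase {g : ℕ → ℕ | Function.update x (Fin.last n) g ∈ X} := by
  cases n with
  | zero =>
    have : {g : ℕ → ℕ | Function.update x (Fin.last 0) g ∈ X} = (fun x => x 0) '' X := by
      have hup : ∀ z : Fin 1 → ℕ → ℕ, Function.update x (Fin.last 0) (z 0) = z := by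
        intro z
        funext i
        fin_cases i
        simp
      ext g
      constructor
      · intro hg
        exact ⟨_, hg, by simp⟩
      · rintro ⟨z, hz, rfl⟩
        rw [Set.mem_ofPred_eq, hup]
        exact hz
    rw [this]
    exact hX
  | succ n =>
    have := hX.2 _ ⟨x, hx, rfl⟩
    have hup : ∀ g, (Fin.snoc (Fin.init x) g : Fin (n + 2) → ℕ → ℕ) =
        Function.update x (Fin.last (n + 1)) g := by
      intro g
      rw [← Fin.update_snoc_last (x := x (Fin.last (n + 1))), Fin.snoc_init_self]
    simpa only [hup] using this

lemma rich_of_isLarge {n : ℕ} {X : Set (Fin (n + 1) → ℕ → ℕ)}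
    {F : (Fin (n + 1) → ℕ → ℕ) → ℝ} (hX : IsLarge (n + 1) X)
    (hF : ∀ x ∈ X, ∀ O : Set (Fin (n + 1) → ℕ → ℕ), IsOpen O → x ∈ O →
      (F '' {z ∈ X ∩ O | ∀ i, i ≠ Fin.last n → z i = x i}).Infinite) : Rich X F := by
  refine fun x hx O hO hxO => ⟨hF x hx O hO hxO, ?_⟩
  obtain ⟨T, hT, hXT⟩ := isLargeBase_update_last hX hx
  have hcont : Continuous fun g : ℕ → ℕ => Function.update x (Fin.last n) g :=
    continuous_const.update _ continuous_id
  obtain ⟨K, hK⟩ := exists_cyl_pre_subset (hO.preimage hcont) (y := x (Fin.last n)) (by simpa)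
  have hxT : x (Fin.last n) ∈ branchSet T := by
    rw [← hXT, Set.mem_ofPred_eq, Function.update_eq_self]
    exact hx
  obtain ⟨s, hs, hps⟩ := hT.2.2.1 _ (hxT K)
  refine ⟨s, hs.2.mono fun m hm => ?_⟩
  obtain ⟨g, hgT, hg⟩ := (pos_branchSet_inter_cyl hT hm).nonempty
  rw [← hXT] at hgT
  refine ⟨_, ⟨hgT, hK (cyl_anti (hps.trans (List.prefix_append _ _)) hg)⟩, fun i hi => ?_, ?_⟩
  · exact Function.update_of_ne hi _ _
  · simpa using hg

/-! ### The map on the limit set -/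

lemma exists_mem_box_subset {n : ℕ} {S : ℕ → Fin n → List ℕ} (hS : Legal n S)
    {x : Fin n → ℕ → ℕ} (hx : x ∈ limitSet n S) {O : Set (Fin n → ℕ → ℕ)} (hO : IsOpen O)
    (hxO : x ∈ O) (N : ℕ) : ∃ k, N ≤ k ∧ x ∈ box (S k) ∧ box (S k) ⊆ O := by
  obtain ⟨I, u, hu, hsub⟩ := isOpen_pi_iff.1 hO x hxO
  have hK : ∀ i, ∃ K, i ∈ I → cyl (pre (x i) K) ⊆ u i := fun i => by
    by_cases hi : i ∈ I
    · obtain ⟨K, hK⟩ := exists_cyl_pre_subset (hu i hi).1 (hu i hi).2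
      exact ⟨K, fun _ => hK⟩
    · exact ⟨0, fun h => absurd h hi⟩
  choose K hK using hK
  obtain ⟨k, hk, hxk, hlen⟩ := exists_mem_box hS hx (max N (Finset.univ.sup K))
  refine ⟨k, (le_max_left _ _).trans hk, hxk, fun z hz => hsub fun i hi => hK i hi ?_⟩
  have hle : K i ≤ (S k i).length :=
    (Finset.le_sup (Finset.mem_univ i)).trans ((le_max_right _ _).trans (hlen i))
  exact mem_cyl_pre.2 fun j hj =>
    ((hz i j (hj.trans_le hle)).symm.trans (hxk i j (hj.trans_le hle)))

theorem exists_isLarge_isEmbedding {n : ℕ} {X : Set (Fin (n + 1) → ℕ → ℕ)}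
    {F : (Fin (n + 1) → ℕ → ℕ) → ℝ} (hX : Init (n + 1) X) (hXcl : IsClosed X) (hR : Rich X F)
    (hF : ContinuousOn F X) :
    ∃ X' : Set (Fin (n + 1) → ℕ → ℕ), X' ⊆ X ∧ IsLarge (n + 1) X' ∧ IsClosed X' ∧
      Topology.IsEmbedding (X'.domRestrict F) := by
  obtain ⟨S, b, D, hS, hb, hDX, hL, hD⟩ := exists_approximation hX hR hF
  replace hS : Legal (n + 1) S := hS
  have hanti : ∀ j k, 1 ≤ j → j ≤ k → D k ⊆ D j := by
    intro j k hj hjk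
    induction k, hjk using Nat.le_induction with
    | base => exact subset_rfl
    | succ k hjk ih =>
      rw [hD k (hj.trans hjk)]
      exact fun x hx => ih hx.1
  have hmeet : ∀ x ∈ limitSet (n + 1) S, ∀ j, 1 ≤ j → ∀ O, IsOpen O → x ∈ O →
      (D j ∩ O).Nonempty := by
    intro x hx j hj O hO hxO
    obtain ⟨k, hk, -, hkO⟩ := exists_mem_box_subset hS hx hO hxO j
    obtain ⟨z, hzD, hz⟩ := (hL (k + 1) (Nat.le_add_left 1 k)).inter_box_nonempty k
      (Nat.lt_succ_self k)
    exact ⟨z, hanti j (k + 1) hj (by omega) hzD, hkO hz⟩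
  have hsub : limitSet (n + 1) S ⊆ X := fun x hx => by
    rw [← hXcl.closure_eq]
    refine mem_closure_iff.2 fun O hO hxO => ?_
    obtain ⟨z, hz, hzO⟩ := hmeet x hx 1 le_rfl O hO hxO
    exact ⟨z, hzO, hDX 1 hz⟩
  have hval : ∀ x ∈ limitSet (n + 1) S, ∀ k, 1 ≤ k → ∀ U : Set ℝ, IsOpen U → F x ∈ U →
      ∀ B, IsOpen B → x ∈ B → ∃ z ∈ D (k + 1), z ∈ B ∧ F z ∈ U := by
    intro x hx k hk U hU hxU B hB hxB
    obtain ⟨O, hO, hOX⟩ := continuousOn_iff'.1 hF U hU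
    have hxO : x ∈ F ⁻¹' U ∩ X := ⟨hxU, hsub hx⟩
    rw [hOX] at hxO
    obtain ⟨z, hzD, hzO, hzB⟩ := hmeet x hx (k + 1) (by omega) _ (hO.inter hB) ⟨hxO.1, hxB⟩
    have hz : z ∈ O ∩ X := ⟨hzO, hDX _ hzD⟩
    rw [← hOX] at hz
    exact ⟨z, hzD, hzB, hz.1⟩
  have hball : ∀ x ∈ limitSet (n + 1) S, ∀ k, 1 ≤ k →
      F x ∈ Metric.ball ((b k).1 : ℝ) (b k).2 → x ∈ box (S k) := by
    intro x hx k hk hFx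
    by_contra hxk
    obtain ⟨z, hzD, hzB, hz⟩ := hval x hx k hk _ Metric.isOpen_ball hFx _
      (isClopen_box (S k)).1.isOpen_compl hxk
    rw [hD k hk] at hzD
    rcases hzD.2 with h | h
    · exact hzB h.1
    · exact h.2 (Metric.ball_subset_closedBall hz)
  have hbox : ∀ x ∈ limitSet (n + 1) S, ∀ k, 1 ≤ k → x ∈ box (S k) →
      F x ∈ Metric.ball ((b k).1 : ℝ) (b k).2 := by
    intro x hx k hk hxk
    by_contra hFx
    have hb' : (0 : ℝ) < (b k).2 := by exact_mod_cast hb k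
    have hFx' : F x ∈ (Metric.closedBall ((b k).1 : ℝ) ((b k).2 / 2))ᶜ := fun h =>
      hFx (Metric.closedBall_subset_ball (by linarith) h)
    obtain ⟨z, hzD, hzB, hz⟩ := hval x hx k hk _ Metric.isClosed_closedBall.isOpen_compl hFx' _
      (isClopen_box (S k)).2 hxk
    rw [hD k hk] at hzD
    rcases hzD.2 with h | h
    · exact hz (Metric.ball_subset_closedBall h.2)
    · exact h.1 hzB
  have hind : Topology.IsInducing ((limitSet (n + 1) S).domRestrict F) := by
    refine Topology.isInducing_iff_nhds.2 fun x => le_antisymm ?_ ?_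
    · exact (hF.mono hsub).domRestrict.continuousAt.le_comap
    · intro V hV
      obtain ⟨V', hV', hVV⟩ := (mem_nhds_subtype _ _ _).1 hV
      obtain ⟨O, hOV, hO, hxO⟩ := mem_nhds_iff.1 hV'
      obtain ⟨k, hk, hxk, hkO⟩ := exists_mem_box_subset hS x.2 hO hxO 1
      refine Filter.mem_comap.2 ⟨_, Metric.isOpen_ball.mem_nhds (hbox x x.2 k hk hxk), ?_⟩
      exact fun z hz => hVV (hOV (hkO (hball z z.2 k hk hz)))
  exact ⟨_, hsub, isLarge_limitSet hS, isClosed_limitSet hS, hind.isEmbedding⟩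

end LargeSet

theorem large_homeomorphism_onto_image (n : ℕ) (hn : 1 ≤ n)
    (X : Set (Fin n → (ℕ → ℕ))) (hX : IsLarge n X) (hXcl : IsClosed X)
    (F : (Fin n → (ℕ → ℕ)) → ℝ) (hF : ContinuousOn F X)
    (huncount : ∀ V : Set (Fin n → (ℕ → ℕ)), V.Nonempty →
      (∃ O : Set (Fin n → (ℕ → ℕ)), IsOpen O ∧ V = X ∩ O) →
      ∀ k : ℕ, k < n → ∀ x ∈ V,
        ¬ (F '' {y ∈ V | ∀ j : Fin n, (j : ℕ) < k → y j = x j}).Countable) :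
    ∃ X' : Set (Fin n → (ℕ → ℕ)), X' ⊆ X ∧ IsLarge n X' ∧ IsClosed X' ∧
      Set.InjOn F X' ∧ Topology.IsEmbedding (X'.restrict F) := by
  obtain ⟨n, rfl⟩ := Nat.exists_eq_add_of_le' hn
  have hR : LargeSet.Rich X F := LargeSet.rich_of_isLarge hX fun x hx O hO hxO hfin => by
    refine huncount (X ∩ O) ⟨x, hx, hxO⟩ ⟨O, hO, rfl⟩ n (Nat.lt_succ_self n) x ⟨hx, hxO⟩
      (hfin.countable.mono (Set.image_mono ?_))
    rintro y ⟨hy, hyx⟩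
    exact ⟨hy, fun i hi => hyx i (Fin.val_lt_last hi)⟩
  obtain ⟨X', hX'X, hX'L, hX'c, hE⟩ :=
    LargeSet.exists_isLarge_isEmbedding (LargeSet.init_of_isLarge hX) hXcl hR hF
  exact ⟨X', hX'X, hX'L, hX'c, Set.injOn_iff_injective.2 hE.injective, hE⟩
end
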